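/- Let F = {(f_1, g_1), …, (f_k, g_k)} (k ≥ 1) be a system of min-plus polynomials in n variables over ℝ∞, each of degree at most d (d ≥ 1), and set N = 2(n+2)²·k·(4d)^{min(n,k)+2}. Then F has no root in ℝ∞^n if and only if there exists a min-plus algebraic combination (f, g) of F of degree at most N such that for every exponent vector I ∈ ℕ^n with |I| ≤ N, either f_I = g_I = +∞, or g_I is finite and g_I < f_I (where +∞ counts as greater than every real), and additionally the constant term g_0 (the coefficient of g at the zero exponent vector) is finite. -/

import Mathlib

open scoped Classical

/-- Exponent vectors in `n` variables. -/
abbrev Exp (n : ℕ) : Type := Fin n → ℕ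

/-- The total degree `|I|` of an exponent vector. -/
def expDeg {n : ℕ} (I : Exp n) : ℕ := ∑ j, I j

/-- A tropical polynomial: a finite nonempty support of exponent vectors
together with real coefficients. -/
structure TropPoly (n : ℕ) where
  supp : Finset (Exp n)
  supp_nonempty : supp.Nonempty
  coeff : Exp n → ℝ

/-- The degree of a tropical polynomial. -/
def TropPoly.deg {n : ℕ} (f : TropPoly n) : ℕ := f.supp.sup expDeg

/-- Value of the monomial of `f` with exponent `I` at a point of `ℝ^n`. -/
def TropPoly.mono {n : ℕ} (f : TropPoly n) (I : Exp n) (a : Fin n → ℝ) : ℝ :=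
  f.coeff I + ∑ j, (I j : ℝ) * a j

/-- Value of a tropical polynomial at a point of `ℝ^n`. -/
def TropPoly.eval {n : ℕ} (f : TropPoly n) (a : Fin n → ℝ) : ℝ :=
  f.supp.inf' f.supp_nonempty (fun I => f.mono I a)

/-- A point of `ℝ^n` is a root if the minimum is attained at two distinct monomials. -/
def TropPoly.IsRoot {n : ℕ} (f : TropPoly n) (a : Fin n → ℝ) : Prop :=
  ∃ I ∈ f.supp, ∃ J ∈ f.supp, I ≠ J ∧
    f.mono I a = f.eval a ∧ f.mono J a = f.eval a

/-- Value of the monomial of `f` with exponent `I` at a point of `ℝ∞^n`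
(with the convention `0 • ⊤ = 0`). -/
noncomputable def TropPoly.monoT {n : ℕ} (f : TropPoly n) (I : Exp n)
    (a : Fin n → WithTop ℝ) : WithTop ℝ :=
  (f.coeff I : WithTop ℝ) + ∑ j, (I j) • a j

/-- Value of a tropical polynomial at a point of `ℝ∞^n`. -/
noncomputable def TropPoly.evalT {n : ℕ} (f : TropPoly n) (a : Fin n → WithTop ℝ) : WithTop ℝ :=
  f.supp.inf (fun I => f.monoT I a)

/-- A point of `ℝ∞^n` is a root if the minimum is `+∞` or is attained at two
distinct monomials. -/
noncomputable def TropPoly.IsRootT {n : ℕ} (f : TropPoly n) (a : Fin n → WithTop ℝ) : Prop :=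
  f.evalT a = ⊤ ∨ ∃ I ∈ f.supp, ∃ J ∈ f.supp, I ≠ J ∧
    f.monoT I a = f.evalT a ∧ f.monoT J a = f.evalT a

/-- The coefficient of the monomial `x^I` in `x^J ⊙ f`, which is `+∞`
unless `I - J` belongs to the support of `f`. -/
noncomputable def shiftCoeff {n : ℕ} (f : TropPoly n) (J I : Exp n) : WithTop ℝ :=
  if J ≤ I ∧ I - J ∈ f.supp then (f.coeff (I - J) : WithTop ℝ) else ⊤

/-- The entry `c_{f}(I-J) + y_I` of the Macaulay system. -/
noncomputable def macVal {n : ℕ} (f : TropPoly n) (J : Exp n)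
    (y : Exp n → WithTop ℝ) (I : Exp n) : WithTop ℝ :=
  shiftCoeff f J I + y I

/-- The data of a min-plus algebraic combination of a system of `k` min-plus polynomials
in `n` variables: a finite nonempty list of tuples `(c_l, J_l, i_l, ε_l)` where `ε_l`
records whether the pair `(f_{i_l}, g_{i_l})` is used swapped. -/
structure MPComb (n k : ℕ) where
  K : ℕ
  K_pos : 0 < K
  c : Fin K → ℝ
  J : Fin K → Exp n
  idx : Fin K → Fin k
  flip : Fin K → Bool

/-- The left polynomial `p_l` associated to the `l`-th tuple. -/
def MPComb.p {n k : ℕ} (comb : MPComb n k) (F : Fin k → TropPoly n × TropPoly n)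
    (l : Fin comb.K) : TropPoly n :=
  if comb.flip l then (F (comb.idx l)).2 else (F (comb.idx l)).1

/-- The right polynomial `q_l` associated to the `l`-th tuple. -/
def MPComb.q {n k : ℕ} (comb : MPComb n k) (F : Fin k → TropPoly n × TropPoly n)
    (l : Fin comb.K) : TropPoly n :=
  if comb.flip l then (F (comb.idx l)).1 else (F (comb.idx l)).2

/-- The coefficient `f_I = min_l (c_l + c_{p_l}(I - J_l))` of the left-hand side of the
combination. -/
noncomputable def MPComb.fCoeff {n k : ℕ} (comb : MPComb n k)
    (F : Fin k → TropPoly n × TropPoly n) (I : Exp n) : WithTop ℝ :=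
  Finset.univ.inf (fun l : Fin comb.K =>
    (comb.c l : WithTop ℝ) + shiftCoeff (comb.p F l) (comb.J l) I)

/-- The coefficient `g_I = min_l (c_l + c_{q_l}(I - J_l))` of the right-hand side of the
combination. -/
noncomputable def MPComb.gCoeff {n k : ℕ} (comb : MPComb n k)
    (F : Fin k → TropPoly n × TropPoly n) (I : Exp n) : WithTop ℝ :=
  Finset.univ.inf (fun l : Fin comb.K =>
    (comb.c l : WithTop ℝ) + shiftCoeff (comb.q F l) (comb.J l) I)

/-- The combination has degree at most `N`. -/
def MPComb.DegLE {n k : ℕ} (comb : MPComb n k) (F : Fin k → TropPoly n × TropPoly n)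
    (N : ℕ) : Prop :=
  ∀ l : Fin comb.K,
    expDeg (comb.J l) + max (F (comb.idx l)).1.deg (F (comb.idx l)).2.deg ≤ N


theorem farkas_alt {V ι : Type*} [AddCommGroup V] [Module ℝ V] (s : Finset ι) :
    ∀ (A : ι → V →ₗ[ℝ] ℝ) (γ : V →ₗ[ℝ] ℝ),
      (∃ u : ι → ℝ, (∀ i, 0 ≤ u i) ∧ γ = ∑ i ∈ s, u i • A i) ∨
      ∃ x, (∀ i ∈ s, A i x ≤ 0) ∧ 0 < γ x := by
  induction s using Finset.induction_on with
  | empty =>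
    intro A γ
    by_cases h : γ = 0
    · left; exact ⟨fun _ => 0, fun _ => le_rfl, by simp [h]⟩
    · right
      obtain ⟨x, hx⟩ : ∃ x, γ x ≠ 0 := by
        by_contra hcon
        push Not at hcon
        exact h (LinearMap.ext hcon)
      rcases lt_or_gt_of_ne hx with h1 | h1
      · exact ⟨-x, by simp, by simpa using h1⟩
      · exact ⟨x, by simp, h1⟩
  | insert j s hj ih =>
    intro A γ
    rcases ih A γ with ⟨u, hu, he⟩ | ⟨x, hx, hγ⟩
    · left
      refine ⟨fun i => if i = j then 0 else u i, fun i => by dsimp only; split_ifs <;> simp [hu], ?_⟩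
      rw [Finset.sum_insert hj, he]
      simp only [if_true, zero_smul, zero_add]
      refine Finset.sum_congr rfl fun i hi => ?_
      rw [if_neg]
      rintro rfl; exact hj hi
    · by_cases hjx : A j x ≤ 0
      · right
        refine ⟨x, ?_, hγ⟩
        intro i hi
        rcases Finset.mem_insert.1 hi with rfl | hi
        · exact hjx
        · exact hx i hi
      · push Not at hjx
        obtain ⟨x1, hx1⟩ : ∃ x1, x1 = (A j x)⁻¹ • x := ⟨_, rfl⟩
        have hinv : 0 < (A j x)⁻¹ := inv_pos.2 hjx
        have hj1 : A j x1 = 1 := by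
          rw [hx1, map_smul, smul_eq_mul, inv_mul_cancel₀ hjx.ne']
        have hxs : ∀ i ∈ s, A i x1 ≤ 0 := by
          intro i hi
          rw [hx1, map_smul, smul_eq_mul]
          exact mul_nonpos_of_nonneg_of_nonpos hinv.le (hx i hi)
        have hg1 : 0 < γ x1 := by
          rw [hx1, map_smul, smul_eq_mul]; positivity
        rcases ih (fun i => A i - (A i x1) • A j) (γ - (γ x1) • A j) with
          ⟨u, hu, he⟩ | ⟨x', hx', hγ'⟩
        · left
          have hnn : 0 ≤ γ x1 - ∑ i ∈ s, u i * A i x1 := by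
            have : ∑ i ∈ s, u i * A i x1 ≤ 0 :=
              Finset.sum_nonpos fun i hi => mul_nonpos_of_nonneg_of_nonpos (hu i) (hxs i hi)
            linarith
          refine ⟨fun i => if i = j then γ x1 - ∑ i ∈ s, u i * A i x1 else u i,
            fun i => by dsimp only; split_ifs; exacts [hnn, hu i], ?_⟩
          rw [Finset.sum_insert hj]
          have h2 : ∑ i ∈ s, (if i = j then γ x1 - ∑ i ∈ s, u i * A i x1 else u i) • A i
              = ∑ i ∈ s, u i • A i := by
            refine Finset.sum_congr rfl fun i hi => ?_
            rw [if_neg]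
            rintro rfl; exact hj hi
          rw [h2]
          ext y
          have he' := LinearMap.congr_fun he y
          simp only [LinearMap.sub_apply, LinearMap.smul_apply, smul_eq_mul, LinearMap.sum_apply,
            if_true, LinearMap.add_apply] at he' ⊢
          have h3 : ∑ i ∈ s, u i * (A i y - A i x1 * A j y)
              = ∑ i ∈ s, u i * A i y - (∑ i ∈ s, u i * A i x1) * A j y := by
            rw [Finset.sum_mul, ← Finset.sum_sub_distrib]
            refine Finset.sum_congr rfl fun i hi => by ring
          rw [h3] at he'
          linarith
        · right
          refine ⟨x' - (A j x') • x1, ?_, ?_⟩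
          · intro i hi
            rcases Finset.mem_insert.1 hi with rfl | hi
            · simp [hj1]
            · have := hx' i hi
              simp only [LinearMap.sub_apply, LinearMap.smul_apply, smul_eq_mul, map_sub,
                map_smul] at this ⊢
              linarith
          · simp only [LinearMap.sub_apply, LinearMap.smul_apply, smul_eq_mul, map_sub,
                map_smul] at hγ' ⊢
            linarith

/-- exponential weight of an extended real. -/
noncomputable def expW (L : ℝ) (v : WithTop ℝ) : ℝ :=
  if v = ⊤ then 0 else Real.exp (-(L * v.untopD 0))

noncomputable def logW (L : ℝ) (Y : ℝ) : WithTop ℝ :=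
  if Y ≤ 0 then ⊤ else ((-(Real.log Y) / L : ℝ) : WithTop ℝ)

theorem expW_nonneg (L : ℝ) (v : WithTop ℝ) : 0 ≤ expW L v := by
  unfold expW; split_ifs
  · exact le_rfl
  · positivity

theorem expW_top (L : ℝ) : expW L ⊤ = 0 := by simp [expW]
theorem expW_coe (L x : ℝ) : expW L (x : WithTop ℝ) = Real.exp (-(L * x)) := by simp [expW]

theorem expW_add (L : ℝ) (a b : WithTop ℝ) : expW L (a + b) = expW L a * expW L b := by
  induction a using WithTop.recTopCoe with
  | top => simp [expW_top]
  | coe a =>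
    induction b using WithTop.recTopCoe with
    | top => simp [expW_top]
    | coe b =>
      rw [← WithTop.coe_add, expW_coe, expW_coe, expW_coe, ← Real.exp_add]
      congr 1; ring

theorem expW_le {L : ℝ} (hL : 0 < L) (a b : WithTop ℝ) : expW L a ≤ expW L b ↔ b ≤ a := by
  induction a using WithTop.recTopCoe with
  | top => simp [expW_top, expW_nonneg]
  | coe a =>
    induction b using WithTop.recTopCoe with
    | top => simp [expW_top, expW_coe, Real.exp_pos]
    | coe b =>
      rw [expW_coe, expW_coe, Real.exp_le_exp, WithTop.coe_le_coe, neg_le_neg_iff,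
        mul_le_mul_iff_right₀ hL]

theorem expW_lt {L : ℝ} (hL : 0 < L) (a b : WithTop ℝ) : expW L a < expW L b ↔ b < a := by
  rw [← not_le, expW_le hL, not_le]

theorem expW_pos (L : ℝ) (a : WithTop ℝ) : 0 < expW L a ↔ a ≠ ⊤ := by
  induction a using WithTop.recTopCoe with
  | top => simp [expW_top]
  | coe a => simp [expW_coe, Real.exp_pos]

theorem expW_logW {L : ℝ} (hL : 0 < L) {Y : ℝ} (hY : 0 ≤ Y) : expW L (logW L Y) = Y := by
  unfold logW
  split_ifs with h
  · rw [expW_top]; exact le_antisymm hY h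
  · push Not at h
    rw [expW_coe]
    have : -(L * (-(Real.log Y) / L)) = Real.log Y := by field_simp
    rw [this, Real.exp_log h]

theorem trop_dual_approx {C R : Type*} [Fintype C] [Fintype R] (P Q : R → C → WithTop ℝ) (c0 : C)
    (ε : ℝ) (hε : 0 < ε) :
    (∃ y : C → WithTop ℝ, y c0 ≠ ⊤ ∧ ∀ r c, ∃ c', P r c' + y c' ≤ Q r c + y c + ((ε + ε : ℝ) : WithTop ℝ)) ∨
    ∃ z : R → WithTop ℝ, (∀ c, (∀ r, z r + Q r c = ⊤ ∧ z r + P r c = ⊤) ∨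
      ∃ r, z r + Q r c ≠ ⊤ ∧ ∀ r', z r + Q r c < z r' + P r' c) ∧ ∃ r, z r + Q r c0 ≠ ⊤ := by
  obtain ⟨m, hmC, hmR, hm1⟩ : ∃ m : ℝ, (Fintype.card C : ℝ) ≤ m ∧ (Fintype.card R : ℝ) < m ∧ 1 < m :=
    ⟨(Fintype.card C : ℝ) + Fintype.card R + 2, by have : (0:ℝ) ≤ Fintype.card R := by positivity
                                                   linarith,
      by have : (0:ℝ) ≤ Fintype.card C := by positivity
         linarith, by
        have : (0:ℝ) ≤ Fintype.card C := by positivity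
        have : (0:ℝ) ≤ Fintype.card R := by positivity
        linarith⟩
  have hm0 : 0 < m := by linarith
  obtain ⟨L, hL, hLm⟩ : ∃ L : ℝ, 0 < L ∧ Real.exp (-(L * ε)) * m * m = m := by
    refine ⟨Real.log m / ε, div_pos (Real.log_pos hm1) hε, ?_⟩
    rw [div_mul_cancel₀ _ hε.ne', Real.exp_neg, Real.exp_log hm0]
    field_simp
  set δ : ℝ := Real.exp (-(L * ε)) with hδ
  have hδpos : 0 < δ := Real.exp_pos _
  have hδm : δ * m = 1 := by
    have : (δ * m) * m = 1 * m := by linarith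
    exact mul_right_cancel₀ hm0.ne' this
  let row : R → (C → ℝ) →ₗ[ℝ] ℝ := fun r =>
    ∑ c, (δ * δ * expW L (Q r c) - δ * expW L (P r c)) • LinearMap.proj c
  have hrow : ∀ r Y, row r Y = ∑ c, (δ * δ * expW L (Q r c) - δ * expW L (P r c)) * Y c := by
    intro r Y
    simp [row, LinearMap.sum_apply]
  let A : (C ⊕ R) → (C → ℝ) →ₗ[ℝ] ℝ := fun i => Sum.elim (fun c => -LinearMap.proj c) row i
  rcases farkas_alt (Finset.univ : Finset (C ⊕ R)) A (LinearMap.proj c0) with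
    ⟨u, hu, he⟩ | ⟨Y, hY, hY0⟩
  · right
    have hcol : ∀ c, ∑ r, u (Sum.inr r) * (δ * expW L (Q r c) - expW L (P r c))
        = (u (Sum.inl c) + if c = c0 then 1 else 0) / δ := by
      intro c
      have h1 := LinearMap.congr_fun he (Pi.single c 1)
      rw [LinearMap.sum_apply, Fintype.sum_sum_type] at h1
      simp only [LinearMap.smul_apply, smul_eq_mul, A, Sum.elim_inl, Sum.elim_inr, hrow,
        LinearMap.neg_apply, LinearMap.proj_apply, Pi.single_apply] at h1
      simp only [mul_ite, mul_one, mul_zero, Finset.sum_ite_eq', Finset.mem_univ, if_true,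
        mul_neg, Finset.sum_neg_distrib] at h1
      have h2 : ∑ x : C, u (Sum.inl x) * (if x = c then (1:ℝ) else 0) = u (Sum.inl c) := by simp
      have h3 : (∑ r, u (Sum.inr r) * (δ * expW L (Q r c) - expW L (P r c))) * δ
        = ∑ r, u (Sum.inr r) * (δ * δ * expW L (Q r c) - δ * expW L (P r c)) := by
        rw [Finset.sum_mul]; refine Finset.sum_congr rfl fun r _ => by ring
      rw [eq_div_iff hδpos.ne', h3]
      have h4 : (if c0 = c then (1:ℝ) else 0) = if c = c0 then 1 else 0 := by
        simp only [eq_comm]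
      rw [← h4, h1]
      simp
    have hcol' : ∀ c, ∑ r, u (Sum.inr r) * expW L (P r c)
        ≤ δ * ∑ r, u (Sum.inr r) * expW L (Q r c) := by
      intro c
      have h1 := hcol c
      have h2 : 0 ≤ (u (Sum.inl c) + if c = c0 then 1 else 0) / δ := by
        apply div_nonneg _ hδpos.le
        have := hu (Sum.inl c)
        split_ifs <;> linarith
      rw [← h1] at h2
      have : ∑ r, u (Sum.inr r) * (δ * expW L (Q r c) - expW L (P r c)) =
        δ * ∑ r, u (Sum.inr r) * expW L (Q r c) - ∑ r, u (Sum.inr r) * expW L (P r c) := by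
        rw [Finset.mul_sum, ← Finset.sum_sub_distrib]
        refine Finset.sum_congr rfl fun r _ => by ring
      linarith
    have hz : ∀ r v, expW L (logW L (u (Sum.inr r)) + v) = u (Sum.inr r) * expW L v := by
      intro r v
      rw [expW_add, expW_logW hL (hu _)]
    have hnn : ∀ r v, 0 ≤ u (Sum.inr r) * expW L v := fun r v =>
      mul_nonneg (hu _) (expW_nonneg _ _)
    refine ⟨fun r => logW L (u (Sum.inr r)), ?_, ?_⟩
    · intro c
      by_cases hall : ∀ r, u (Sum.inr r) * expW L (Q r c) = 0
      · left
        have hP : ∑ r, u (Sum.inr r) * expW L (P r c) = 0 := by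
          apply le_antisymm _ (Finset.sum_nonneg fun r _ => hnn r _)
          refine (hcol' c).trans ?_
          simp [hall]
        rw [Finset.sum_eq_zero_iff_of_nonneg (fun r _ => hnn r _)] at hP
        intro r
        constructor
        · by_contra hne
          have := (expW_pos L _).2 hne
          rw [hz, hall r] at this
          exact lt_irrefl _ this
        · by_contra hne
          have := (expW_pos L _).2 hne
          rw [hz, hP r (Finset.mem_univ _)] at this
          exact lt_irrefl _ this
      · right
        push Not at hall
        obtain ⟨r1, hr1⟩ := hall
        obtain ⟨r, -, hr⟩ := Finset.exists_max_image (Finset.univ : Finset R)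
          (fun r => u (Sum.inr r) * expW L (Q r c)) ⟨r1, Finset.mem_univ _⟩
        have hpos : 0 < u (Sum.inr r) * expW L (Q r c) :=
          lt_of_lt_of_le (lt_of_le_of_ne (hnn _ _) (Ne.symm hr1)) (hr r1 (Finset.mem_univ _))
        refine ⟨r, (expW_pos L _).1 (by rw [hz]; exact hpos), ?_⟩
        intro r'
        rw [← expW_lt hL, hz, hz]
        have h1 : u (Sum.inr r') * expW L (P r' c) ≤ ∑ r, u (Sum.inr r) * expW L (P r c) :=
          Finset.single_le_sum (f := fun r => u (Sum.inr r) * expW L (P r c))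
            (fun r _ => hnn r _) (Finset.mem_univ r')
        have h2 : ∑ r, u (Sum.inr r) * expW L (Q r c)
            ≤ (Fintype.card R : ℝ) * (u (Sum.inr r) * expW L (Q r c)) := by
          have := Finset.sum_le_card_nsmul (Finset.univ : Finset R)
            (fun r => u (Sum.inr r) * expW L (Q r c)) _ hr
          simpa using this
        calc _ ≤ _ := h1
          _ ≤ _ := hcol' c
          _ ≤ δ * ((Fintype.card R : ℝ) * (u (Sum.inr r) * expW L (Q r c))) := by gcongr
          _ < δ * (m * (u (Sum.inr r) * expW L (Q r c))) := by gcongr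
          _ = (δ * m) * (u (Sum.inr r) * expW L (Q r c)) := by ring
          _ = _ := by rw [hδm, one_mul]
    · by_contra hcon
      push Not at hcon
      have hq : ∀ r, u (Sum.inr r) * expW L (Q r c0) = 0 := by
        intro r
        rw [← hz, hcon r, expW_top]
      have h1 := hcol c0
      have h2 : ∑ r, u (Sum.inr r) * (δ * expW L (Q r c0) - expW L (P r c0)) ≤ 0 := by
        apply Finset.sum_nonpos
        intro r _
        have : u (Sum.inr r) * (δ * expW L (Q r c0) - expW L (P r c0))
          = δ * (u (Sum.inr r) * expW L (Q r c0)) - u (Sum.inr r) * expW L (P r c0) := by ring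
        rw [this, hq r]
        have := hnn r (P r c0)
        linarith
      rw [h1] at h2
      have h3 : 0 < (u (Sum.inl c0) + if c0 = c0 then 1 else 0) / δ := by
        apply div_pos _ hδpos
        have := hu (Sum.inl c0)
        simp; linarith
      linarith
  · left
    have hYnn : ∀ c, 0 ≤ Y c := by
      intro c
      have := hY (Sum.inl c) (Finset.mem_univ _)
      simp only [A, Sum.elim_inl, LinearMap.neg_apply, LinearMap.proj_apply] at this
      linarith
    refine ⟨fun c => logW L (Y c), ?_, ?_⟩
    · apply (expW_pos L _).1
      rw [expW_logW hL (hYnn _)]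
      exact hY0
    · intro r c
      have h1 := hY (Sum.inr r) (Finset.mem_univ _)
      simp only [A, Sum.elim_inr, hrow] at h1
      have h2 : δ * ∑ c, expW L (Q r c) * Y c ≤ ∑ c, expW L (P r c) * Y c := by
        have : ∑ c, (δ * δ * expW L (Q r c) - δ * expW L (P r c)) * Y c
          = δ * (δ * ∑ c, expW L (Q r c) * Y c - ∑ c, expW L (P r c) * Y c) := by
          rw [Finset.mul_sum, ← Finset.sum_sub_distrib, Finset.mul_sum]
          refine Finset.sum_congr rfl fun r _ => by ring
        rw [this] at h1
        have := nonpos_of_mul_nonpos_right h1 hδpos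
        linarith
      have hnn : ∀ v c, 0 ≤ expW L v * Y c := fun v c =>
        mul_nonneg (expW_nonneg _ _) (hYnn _)
      obtain ⟨c', -, hc'⟩ := Finset.exists_max_image (Finset.univ : Finset C)
          (fun c => expW L (P r c) * Y c) ⟨c0, Finset.mem_univ _⟩
      refine ⟨c', ?_⟩
      rw [← expW_le hL, expW_add, expW_add, expW_add, expW_logW hL (hYnn _),
        expW_logW hL (hYnn _), expW_coe]
      have hδδ : Real.exp (-(L * (ε + ε))) = δ * δ := by
        rw [hδ, ← Real.exp_add]; congr 1; ring
      rw [hδδ]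
      have h3 : expW L (Q r c) * Y c ≤ ∑ c, expW L (Q r c) * Y c :=
          Finset.single_le_sum (f := fun c => expW L (Q r c) * Y c)
            (fun c _ => hnn _ c) (Finset.mem_univ c)
      have h4 : ∑ c, expW L (P r c) * Y c
            ≤ (Fintype.card C : ℝ) * (expW L (P r c') * Y c') := by
          have := Finset.sum_le_card_nsmul (Finset.univ : Finset C)
            (fun c => expW L (P r c) * Y c) _ hc'
          simpa using this
      have h5 : δ * (expW L (Q r c) * Y c) ≤ m * (expW L (P r c') * Y c') := by
        calc _ ≤ δ * ∑ c, expW L (Q r c) * Y c := by gcongr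
          _ ≤ _ := h2
          _ ≤ _ := h4
          _ ≤ _ := by
            have := hnn (P r c') c'
            gcongr
      calc expW L (Q r c) * Y c * (δ * δ) = δ * (δ * (expW L (Q r c) * Y c)) := by ring
        _ ≤ δ * (m * (expW L (P r c') * Y c')) := by gcongr
        _ = (δ * m) * (expW L (P r c') * Y c') := by ring
        _ = _ := by rw [hδm, one_mul]

theorem trop_closure {C R : Type*} [Fintype C] [Fintype R] (P Q : R → C → WithTop ℝ) (c0 : C)
    (h : ∀ ε : ℝ, 0 < ε → ∃ y : C → WithTop ℝ, y c0 ≠ ⊤ ∧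
      ∀ r c, ∃ c', P r c' + y c' ≤ Q r c + y c + ((ε : ℝ) : WithTop ℝ)) :
    ∃ y : C → WithTop ℝ, y c0 ≠ ⊤ ∧ ∀ r c, ∃ c', P r c' + y c' ≤ Q r c + y c := by
  have hpos : ∀ m : ℕ, (0:ℝ) < 1 / ((m:ℝ) + 1) := fun m => by positivity
  choose y hy0 φ hφ using fun m : ℕ => h _ (hpos m)
  let pat : ℕ → Finset C × (R → C → C) := fun m => (Finset.univ.filter fun c => y m c ≠ ⊤, φ m)
  obtain ⟨⟨C', ψ⟩, hinf⟩ := Finite.exists_infinite_fiber pat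
  have hinf' : (pat ⁻¹' {(C', ψ)}).Infinite := Set.infinite_coe_iff.1 hinf
  have hmem : ∀ m ∈ pat ⁻¹' {(C', ψ)}, (∀ c, c ∈ C' ↔ y m c ≠ ⊤) ∧ φ m = ψ := by
    intro m hm
    have hm : pat m = (C', ψ) := hm
    have h1 : (Finset.univ.filter fun c => y m c ≠ ⊤) = C' := congrArg Prod.fst hm
    have h2 : φ m = ψ := congrArg Prod.snd hm
    refine ⟨fun c => ?_, h2⟩
    rw [← h1]; simp
  let S : Finset (R × C) := Finset.univ.filter fun rc => rc.2 ∈ C' ∧ Q rc.1 rc.2 ≠ ⊤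
  let b : R × C → ℝ := fun rc => (Q rc.1 rc.2).untopD 0 - (P rc.1 (ψ rc.1 rc.2)).untopD 0
  let A : R × C → ((C → ℝ) × ℝ) →ₗ[ℝ] ℝ := fun rc =>
    ((LinearMap.proj (ψ rc.1 rc.2) : (C → ℝ) →ₗ[ℝ] ℝ) - LinearMap.proj rc.2) ∘ₗ LinearMap.fst ℝ _ _
      - b rc • LinearMap.snd ℝ _ _
  have hA : ∀ rc x s, A rc (x, s) = x (ψ rc.1 rc.2) - x rc.2 - b rc * s := by
    intro rc x s; simp [A]
  have key : ∀ m ∈ pat ⁻¹' {(C', ψ)}, ∀ rc ∈ S, ψ rc.1 rc.2 ∈ C' ∧ P rc.1 (ψ rc.1 rc.2) ≠ ⊤ ∧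
      A rc (fun c => (y m c).untopD 0, 1) ≤ 1 / ((m:ℝ) + 1) := by
    rintro m hm ⟨r, c⟩ hrc
    obtain ⟨h1, h2⟩ := hmem m hm
    simp only [S, Finset.mem_filter, Finset.mem_univ, true_and] at hrc
    have h3 := hφ m r c
    rw [h2] at h3
    rw [hA]
    simp only [b]
    have h4 := (h1 c).1 hrc.1
    rw [h1]
    obtain ⟨q, hq⟩ := WithTop.ne_top_iff_exists.1 hrc.2
    obtain ⟨yc, hyc⟩ := WithTop.ne_top_iff_exists.1 h4
    rw [← hq, ← hyc] at h3
    have h5 : P r (ψ r c) + y m (ψ r c) ≠ ⊤ := by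
      refine ne_top_of_le_ne_top ?_ h3
      rw [← WithTop.coe_add, ← WithTop.coe_add]
      exact WithTop.coe_ne_top
    rw [WithTop.add_ne_top] at h5
    refine ⟨h5.2, h5.1, ?_⟩
    obtain ⟨p, hp⟩ := WithTop.ne_top_iff_exists.1 h5.1
    obtain ⟨yp, hyp⟩ := WithTop.ne_top_iff_exists.1 h5.2
    rw [← hp, ← hyp] at h3
    rw [← hp, ← hyp, ← hq, ← hyc]
    norm_cast at h3
    push_cast at h3
    simp only [WithTop.untopD_coe]
    linarith
  obtain ⟨m0, hm0⟩ := hinf'.nonempty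
  rcases farkas_alt S A (LinearMap.snd ℝ (C → ℝ) ℝ) with ⟨u, hu, he⟩ | ⟨⟨x, s⟩, hx, hs⟩
  · exfalso
    obtain ⟨k, hk⟩ := exists_nat_gt (∑ i ∈ S, u i)
    obtain ⟨m, hm, hkm⟩ := hinf'.exists_gt k
    have h1 := LinearMap.congr_fun he (fun c => (y m c).untopD 0, 1)
    simp only [LinearMap.snd_apply, LinearMap.sum_apply, LinearMap.smul_apply, smul_eq_mul] at h1
    have h2 : ∑ i ∈ S, u i * A i (fun c => (y m c).untopD 0, 1)
        ≤ ∑ i ∈ S, u i * (1 / ((m:ℝ) + 1)) :=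
      Finset.sum_le_sum fun i hi => mul_le_mul_of_nonneg_left (key m hm i hi).2.2 (hu i)
    rw [← Finset.sum_mul, ← h1, mul_one_div, le_div_iff₀ (by positivity)] at h2
    have h3 : (k:ℝ) < m := by exact_mod_cast hkm
    linarith
  · simp only [LinearMap.snd_apply] at hs
    refine ⟨fun c => if c ∈ C' then ((x c / s : ℝ) : WithTop ℝ) else ⊤, ?_, ?_⟩
    · have : c0 ∈ C' := ((hmem m0 hm0).1 c0).2 (hy0 m0)
      simp [this]
    · intro r c
      by_cases hrc : (r, c) ∈ S
      · obtain ⟨h1, h2, -⟩ := key m0 hm0 _ hrc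
        have h3 := hx _ hrc
        rw [hA] at h3
        simp only [S, Finset.mem_filter, Finset.mem_univ, true_and] at hrc
        refine ⟨ψ r c, ?_⟩
        simp only at h1 h2 h3
        beta_reduce
        rw [if_pos h1, if_pos hrc.1]
        obtain ⟨q, hq⟩ := WithTop.ne_top_iff_exists.1 hrc.2
        obtain ⟨p, hp⟩ := WithTop.ne_top_iff_exists.1 h2
        simp only [b, ← hq, ← hp, WithTop.untopD_coe] at h3
        rw [← hq, ← hp]
        norm_cast
        have h4 : (x (ψ r c) - x c) / s ≤ q - p := by
          rw [div_le_iff₀ hs]; linarith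
        rw [sub_div] at h4
        linarith
      · refine ⟨c0, ?_⟩
        simp only [S, Finset.mem_filter, Finset.mem_univ, true_and, not_and, not_not] at hrc
        by_cases hc : c ∈ C'
        · rw [hrc hc]; simp
        · simp [hc]

theorem trop_dual {C R : Type*} [Fintype C] [Fintype R] (P Q : R → C → WithTop ℝ) (c0 : C) :
    (∃ y : C → WithTop ℝ, y c0 ≠ ⊤ ∧ ∀ r c, ∃ c', P r c' + y c' ≤ Q r c + y c) ∨
    ∃ z : R → WithTop ℝ, (∀ c, (∀ r, z r + Q r c = ⊤ ∧ z r + P r c = ⊤) ∨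
      ∃ r, z r + Q r c ≠ ⊤ ∧ ∀ r', z r + Q r c < z r' + P r' c) ∧ ∃ r, z r + Q r c0 ≠ ⊤ := by
  by_contra hcon
  rw [not_or] at hcon
  apply hcon.1
  apply trop_closure
  intro ε hε
  rcases trop_dual_approx P Q c0 (ε / 2) (by positivity) with h | h
  · simpa using h
  · exact absurd h hcon.2

/-- Feasible weights for the mixed cell argument. -/
def Feas {ι κ : Type*} [Fintype ι] {n : ℕ} (e : ι → κ) (vec : ι → Fin n → ℕ)
    (lam : ι → ℝ) (I : Fin n → ℕ) : Prop :=
  (∀ x, 0 ≤ lam x) ∧ (∀ k, ∑ x with e x = k, lam x = (n:ℝ) + 2) ∧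
    ∀ j, ∑ x, lam x * (vec x j : ℝ) = I j

/-- Minimizers of the cost. -/
def FeasMin {ι κ : Type*} [Fintype ι] {n : ℕ} (e : ι → κ) (vec : ι → Fin n → ℕ) (c : ι → ℝ)
    (z : (Fin n → ℕ) → WithTop ℝ) (lam : ι → ℝ) (I : Fin n → ℕ) : Prop :=
  Feas e vec lam I ∧ z I ≠ ⊤ ∧ ∀ lam' I', Feas e vec lam' I' → z I' ≠ ⊤ →
    ∑ x, lam x * c x + (z I).untopD 0 ≤ ∑ x, lam' x * c x + (z I').untopD 0

theorem Feas.le {ι κ : Type*} [Fintype ι] {n : ℕ} {e : ι → κ} {vec : ι → Fin n → ℕ}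
    {lam : ι → ℝ} {I : Fin n → ℕ} (h : Feas e vec lam I) (x : ι) : lam x ≤ n + 2 := by
  rw [← h.2.1 (e x)]
  exact Finset.single_le_sum (f := lam) (fun i _ => h.1 i) (by simp)

theorem exists_feasMin {ι κ : Type*} [Fintype ι] {n : ℕ} (e : ι → κ) (vec : ι → Fin n → ℕ)
    (c : ι → ℝ) (z : (Fin n → ℕ) → WithTop ℝ) (h : ∃ lam I, Feas e vec lam I ∧ z I ≠ ⊤) :
    ∃ lam I, FeasMin e vec c z lam I := by
  have step : ∀ I, (∃ lam, Feas e vec lam I) → ∃ lam, Feas e vec lam I ∧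
      ∀ lam', Feas e vec lam' I → ∑ x, lam x * c x ≤ ∑ x, lam' x * c x := by
    intro I hI
    have hcl : IsClosed {lam : ι → ℝ | Feas e vec lam I} := by
      simp only [Feas, Set.ofPred_and, Set.ofPred_forall]
      refine IsClosed.inter (isClosed_iInter fun x => ?_) (IsClosed.inter
        (isClosed_iInter fun k => ?_) (isClosed_iInter fun j => ?_))
      · exact isClosed_le (by fun_prop) (by fun_prop)
      · exact isClosed_eq (by fun_prop) (by fun_prop)
      · exact isClosed_eq (by fun_prop) (by fun_prop)
    have hco : IsCompact {lam : ι → ℝ | Feas e vec lam I} := by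
      refine IsCompact.of_isClosed_subset (isCompact_Icc (a := (0 : ι → ℝ)) (b := fun _ => (n:ℝ)+2))
        hcl fun lam hl => ?_
      exact ⟨fun x => hl.1 x, fun x => hl.le x⟩
    obtain ⟨lam, hl, hm⟩ := hco.exists_isMinOn hI
      (f := fun lam => ∑ x, lam x * c x) (by fun_prop)
    exact ⟨lam, hl, fun lam' h' => hm h'⟩
  choose! g hg1 hg2 using step
  have hfin : {I | (∃ lam, Feas e vec lam I) ∧ z I ≠ ⊤}.Finite := by
    refine (Set.finite_Iic (fun j => ⌊∑ x, ((n:ℝ)+2) * vec x j⌋₊)).subset ?_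
    rintro I ⟨⟨lam, hl⟩, -⟩ j
    refine Nat.le_floor ?_
    rw [← hl.2.2 j]
    exact Finset.sum_le_sum fun x _ => mul_le_mul_of_nonneg_right (hl.le x) (by positivity)
  obtain ⟨lam, I, hl, hz⟩ := h
  obtain ⟨I0, hI0, hmin⟩ := Set.exists_min_image _
    (fun I => ∑ x, g I x * c x + (z I).untopD 0) hfin ⟨I, ⟨lam, hl⟩, hz⟩
  refine ⟨g I0, I0, hg1 _ hI0.1, hI0.2, fun lam' I' h1 h2 => ?_⟩
  refine (hmin I' ⟨⟨lam', h1⟩, h2⟩).trans ?_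
  have := hg2 I' ⟨lam', h1⟩ lam' h1
  linarith

theorem exists_feasMin_max {ι κ : Type*} [Fintype ι] {n : ℕ} (e : ι → κ) (vec : ι → Fin n → ℕ)
    (c : ι → ℝ) (z : (Fin n → ℕ) → WithTop ℝ) (h : ∃ lam I, Feas e vec lam I ∧ z I ≠ ⊤) :
    ∃ lam I, FeasMin e vec c z lam I ∧ ∀ lam' I', FeasMin e vec c z lam' I' →
      (Finset.univ.filter fun x => 0 < lam' x).card ≤ (Finset.univ.filter fun x => 0 < lam x).card := by
  obtain ⟨lam0, I0, h0⟩ := exists_feasMin e vec c z h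
  obtain ⟨s, ⟨lam, I, hm, hs⟩, hmax⟩ := Set.exists_max_image
    {s : Finset ι | ∃ lam I, FeasMin e vec c z lam I ∧ s = Finset.univ.filter fun x => 0 < lam x}
    Finset.card (Set.toFinite _) ⟨_, lam0, I0, h0, rfl⟩
  refine ⟨lam, I, hm, fun lam' I' h' => ?_⟩
  rw [← hs]
  exact hmax _ ⟨lam', I', h', rfl⟩

theorem feasMin_perturb {ι κ : Type*} [Fintype ι] {n : ℕ} (e : ι → κ) (vec : ι → Fin n → ℕ)
    (c : ι → ℝ) (z : (Fin n → ℕ) → WithTop ℝ) (lam : ι → ℝ) (I : Fin n → ℕ)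
    (hm : FeasMin e vec c z lam I)
    (hmax : ∀ lam' I', FeasMin e vec c z lam' I' →
      (Finset.univ.filter fun x => 0 < lam' x).card ≤ (Finset.univ.filter fun x => 0 < lam x).card)
    (μ : ι → ℝ) (h1 : ∀ j, ∑ x, μ x * (vec x j : ℝ) = 0) (h2 : ∀ k, ∑ x with e x = k, μ x = 0)
    (h3 : ∀ x, lam x = 0 → 0 ≤ μ x) :
    0 ≤ ∑ x, μ x * c x ∧ (∑ x, μ x * c x ≤ 0 → ∀ x, lam x = 0 → μ x = 0) := by
  obtain ⟨⟨ha, hb, hc⟩, hz, hopt⟩ := hm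
  have hev : ∀ᶠ ε : ℝ in nhdsWithin 0 (Set.Ioi 0), ∀ x, 0 < lam x → 0 < lam x + ε * μ x := by
    rw [Filter.eventually_all]
    intro x
    by_cases hx : 0 < lam x
    · have : Filter.Tendsto (fun ε : ℝ => lam x + ε * μ x) (nhdsWithin 0 (Set.Ioi 0))
          (nhds (lam x + 0 * μ x)) := by
        refine tendsto_nhdsWithin_of_tendsto_nhds ?_
        exact Continuous.tendsto (by fun_prop) 0
      rw [zero_mul, add_zero] at this
      filter_upwards [this.eventually (lt_mem_nhds hx)] with ε hε _ using hε
    · exact Filter.Eventually.of_forall fun ε h => absurd h hx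
  obtain ⟨ε, hε, hε0⟩ := (hev.and self_mem_nhdsWithin).exists
  have hε0 : 0 < ε := hε0
  have hF : Feas e vec (fun x => lam x + ε * μ x) I := by
    refine ⟨fun x => ?_, fun k => ?_, fun j => ?_⟩
    · rcases (ha x).eq_or_lt with h | h
      · have := mul_nonneg hε0.le (h3 x h.symm)
        simp only [← h]; linarith
      · exact (hε x h).le
    · rw [Finset.sum_add_distrib, ← Finset.mul_sum, h2, hb]; ring
    · simp only [add_mul, mul_assoc]
      rw [Finset.sum_add_distrib, ← Finset.mul_sum, h1, hc]; ring
  have hcost : ∑ x, (lam x + ε * μ x) * c x = ∑ x, lam x * c x + ε * ∑ x, μ x * c x := by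
    simp only [add_mul, mul_assoc]
    rw [Finset.sum_add_distrib, ← Finset.mul_sum]
  have h4 : 0 ≤ ∑ x, μ x * c x := by
    have := hopt _ _ hF hz
    rw [hcost] at this
    have h5 : 0 ≤ ε * ∑ x, μ x * c x := by linarith
    exact nonneg_of_mul_nonneg_right h5 hε0
  refine ⟨h4, fun h5 x hx => ?_⟩
  have h6 : ∑ x, μ x * c x = 0 := le_antisymm h5 h4
  have hM : FeasMin e vec c z (fun x => lam x + ε * μ x) I := by
    refine ⟨hF, hz, fun lam' I' h7 h8 => ?_⟩
    rw [hcost, h6, mul_zero, add_zero]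
    exact hopt _ _ h7 h8
  by_contra hne
  have hpos : 0 < μ x := lt_of_le_of_ne (h3 x hx) (Ne.symm hne)
  have := hmax _ _ hM
  have hlt : (Finset.univ.filter fun x => 0 < lam x).card <
      (Finset.univ.filter fun x => 0 < lam x + ε * μ x).card := by
    apply Finset.card_lt_card
    rw [Finset.ssubset_iff_of_subset]
    · refine ⟨x, ?_, ?_⟩
      · simp only [Finset.mem_filter, Finset.mem_univ, true_and, hx]
        have := mul_pos hε0 hpos
        linarith
      · simp [hx]
    · intro y hy
      simp only [Finset.mem_filter, Finset.mem_univ, true_and] at hy ⊢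
      exact hε y hy
  omega

theorem feasMin_dual {ι κ : Type*} [Fintype ι] [Fintype κ] {n : ℕ} (e : ι → κ)
    (vec : ι → Fin n → ℕ)
    (c : ι → ℝ) (z : (Fin n → ℕ) → WithTop ℝ) (lam : ι → ℝ) (I : Fin n → ℕ)
    (hm : FeasMin e vec c z lam I)
    (hmax : ∀ lam' I', FeasMin e vec c z lam' I' →
      (Finset.univ.filter fun x => 0 < lam' x).card ≤ (Finset.univ.filter fun x => 0 < lam x).card) :
    ∃ (a : Fin n → ℝ) (t : κ → ℝ), ∀ x, t (e x) ≤ c x + ∑ j, (vec x j : ℝ) * a j ∧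
      (0 < lam x ↔ c x + ∑ j, (vec x j : ℝ) * a j = t (e x)) := by
  let Sf : ((Fin n → ℝ) × (κ → ℝ) × ℝ) →ₗ[ℝ] ℝ := LinearMap.snd ℝ (κ → ℝ) ℝ ∘ₗ LinearMap.snd ℝ (Fin n → ℝ) _
  let L : ι → ((Fin n → ℝ) × (κ → ℝ) × ℝ) →ₗ[ℝ] ℝ := fun x =>
    c x • Sf + ∑ j, (vec x j : ℝ) • ((LinearMap.proj j : (Fin n → ℝ) →ₗ[ℝ] ℝ) ∘ₗ LinearMap.fst ℝ _ _)
      - (LinearMap.proj (e x) : (κ → ℝ) →ₗ[ℝ] ℝ) ∘ₗ LinearMap.fst ℝ _ ℝ ∘ₗ LinearMap.snd ℝ _ _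
  have hSf : ∀ a t s, Sf (a, t, s) = s := fun a t s => rfl
  have hL : ∀ x a t s, L x (a, t, s) = c x * s + ∑ j, (vec x j : ℝ) * a j - t (e x) := by
    intro x a t s
    simp [L, hSf, LinearMap.sum_apply]
  let A : ι ⊕ ι ⊕ Unit → ((Fin n → ℝ) × (κ → ℝ) × ℝ) →ₗ[ℝ] ℝ := fun i => match i with
    | .inl x => - L x
    | .inr (.inl x) => if 0 < lam x then L x else 0
    | .inr (.inr _) => - Sf
  have rel : ∀ (μ : ι → ℝ) (δ : ℝ), 0 ≤ δ → (∀ x, lam x = 0 → 0 ≤ μ x) →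
      (∀ v, ∑ x, μ x * L x v = - δ * Sf v) → δ = 0 ∧ ∀ x, lam x = 0 → μ x = 0 := by
    intro μ δ hδ hμ hev
    have e1 : ∀ j, ∑ x, μ x * (vec x j : ℝ) = 0 := by
      intro j
      have := hev (Pi.single j 1, 0, 0)
      simpa [hL, hSf, Pi.single_apply] using this
    have e2 : ∀ k, ∑ x with e x = k, μ x = 0 := by
      intro k
      have := hev (0, Pi.single k 1, 0)
      simp only [hL, hSf] at this
      rw [Finset.sum_filter]
      simpa [Pi.single_apply] using this
    have e3 : ∑ x, μ x * c x = - δ := by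
      have := hev (0, 0, 1)
      simpa [hL, hSf] using this
    obtain ⟨p1, p2⟩ := feasMin_perturb e vec c z lam I hm hmax μ e1 e2 hμ
    rw [e3] at p1 p2
    exact ⟨by linarith, p2 (by linarith)⟩
  have expand : ∀ (u : ι ⊕ ι ⊕ Unit → ℝ) v, (∑ i, u i • A i) v =
      - ∑ x, (u (.inl x) - (if 0 < lam x then u (.inr (.inl x)) else 0)) * L x v
        - u (.inr (.inr ())) * Sf v := by
    intro u v
    have h1 : ∀ x, u (.inr (.inl x)) * (if 0 < lam x then L x else 0) v
        = (if 0 < lam x then u (.inr (.inl x)) else 0) * L x v := by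
      intro x; split_ifs <;> simp
    rw [LinearMap.sum_apply]
    simp only [LinearMap.smul_apply, smul_eq_mul, Fintype.sum_sum_type, A, LinearMap.neg_apply,
      h1, sub_mul, Finset.sum_sub_distrib, Finset.sum_neg_distrib, mul_neg,
      Finset.univ_unique, Finset.sum_singleton]
    ring_nf
  have sol0 : ∃ v, (∀ i, A i v ≤ 0) ∧ 0 < Sf v := by
    rcases farkas_alt Finset.univ A Sf with ⟨u, hu, he⟩ | ⟨v, h1, h2⟩
    · exfalso
      have := (rel (fun x => u (.inl x) - (if 0 < lam x then u (.inr (.inl x)) else 0))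
        (1 + u (.inr (.inr ()))) (by have := hu (.inr (.inr ())); linarith) ?_ ?_).1
      · have := hu (.inr (.inr ())); linarith
      · intro x hx; simp [hx, hu]
      · intro v
        have h9 := LinearMap.congr_fun he v
        rw [expand] at h9
        linarith
    · exact ⟨v, fun i => h1 i (Finset.mem_univ _), h2⟩
  have solx : ∀ x0, ∃ v, (∀ i, A i v ≤ 0) ∧ (lam x0 = 0 → 0 < L x0 v) := by
    intro x0
    by_cases hx0 : lam x0 = 0
    swap
    · exact ⟨0, by simp, fun h => absurd h hx0⟩
    rcases farkas_alt Finset.univ A (L x0) with ⟨u, hu, he⟩ | ⟨v, h1, h2⟩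
    · exfalso
      have := (rel (fun x => u (.inl x) - (if 0 < lam x then u (.inr (.inl x)) else 0)
          + (if x = x0 then 1 else 0))
        (u (.inr (.inr ()))) (hu _) ?_ ?_).2 x0 hx0
      · have h9 := hu (.inl x0)
        simp [hx0] at this
        linarith
      · intro x hx
        have h9 := hu (.inl x)
        simp only [hx, lt_irrefl, if_false]
        split_ifs <;> linarith
      · intro v
        have h9 := LinearMap.congr_fun he v
        rw [expand] at h9
        simp only [add_mul, Finset.sum_add_distrib, ite_mul, one_mul, zero_mul,
          Finset.sum_ite_eq', Finset.mem_univ, if_true]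
        simp only [sub_mul, ite_mul, zero_mul] at h9
        simp only [sub_mul, ite_mul, zero_mul]
        linarith
    · exact ⟨v, fun i => h1 i (Finset.mem_univ _), fun _ => h2⟩
  obtain ⟨v0, hv0, hs0⟩ := sol0
  choose vx hvx hsx using solx
  obtain ⟨v, hvdef⟩ : ∃ v, v = v0 + ∑ x, vx x := ⟨_, rfl⟩
  have hLx : ∀ x, ∀ v, (∀ i, A i v ≤ 0) → 0 ≤ L x v ∧ (0 < lam x → L x v = 0) ∧ 0 ≤ Sf v := by
    intro x v hv
    have q1 := hv (.inl x)
    have q2 := hv (.inr (.inl x))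
    have q3 := hv (.inr (.inr ()))
    simp only [A, LinearMap.neg_apply] at q1 q2 q3
    refine ⟨by linarith, fun h => ?_, by linarith⟩
    rw [if_pos h] at q2
    linarith
  have hvA : ∀ i, A i v ≤ 0 := by
    intro i
    rw [hvdef, map_add, map_sum]
    have := Finset.sum_nonpos (s := Finset.univ) fun x _ => hvx x i
    have := hv0 i
    linarith
  have hvs : 0 < Sf v := by
    rw [hvdef, map_add, map_sum]
    have := Finset.sum_nonneg (s := Finset.univ) fun x _ => (hLx x _ (hvx x)).2.2
    linarith
  have hvL : ∀ x, lam x = 0 → 0 < L x v := by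
    intro x hx
    rw [hvdef, map_add, map_sum]
    have h1 := Finset.single_le_sum (s := Finset.univ) (f := fun y => L x (vx y))
      (fun y _ => (hLx x _ (hvx y)).1) (Finset.mem_univ x)
    have h2 := hsx x hx
    have h3 := (hLx x _ hv0).1
    beta_reduce at h1
    linarith
  obtain ⟨a, t, s⟩ := v
  rw [hSf] at hvs
  have hdiv : ∀ x, c x + ∑ j, (vec x j : ℝ) * (a j / s) - t (e x) / s = L x (a, t, s) / s := by
    intro x
    rw [hL, sub_div, add_div, mul_div_cancel_right₀ _ hvs.ne', Finset.sum_div]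
    simp only [mul_div_assoc]
  refine ⟨fun j => a j / s, fun k => t k / s, fun x => ⟨?_, ?_⟩⟩
  · have := div_nonneg (hLx x _ hvA).1 hvs.le
    rw [← hdiv] at this
    linarith
  · constructor
    · intro h
      have := (hLx x _ hvA).2.1 h
      have h2 := hdiv x
      rw [this, zero_div] at h2
      linarith
    · intro h
      by_contra hcon
      have hx : lam x = 0 := le_antisymm (not_lt.1 hcon) (hm.1.1 x)
      have := div_pos (hvL x hx) hvs
      rw [← hdiv] at this
      beta_reduce at h
      linarith

theorem feas_carath {ι κ : Type*} [Fintype ι] {n : ℕ} {e : ι → κ} {vec : ι → Fin n → ℕ}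
    {lam : ι → ℝ} {I : Fin n → ℕ} (hF : Feas e vec lam I) (k : κ) :
    ∃ lam', Feas e vec lam' I ∧ (∀ x, lam x = 0 → lam' x = 0) ∧ ∃ x, e x = k ∧ 1 < lam' x := by
  obtain ⟨ha, hb, hc⟩ := hF
  have hn : (0:ℝ) < n + 2 := by positivity
  let pt : ι → Fin n → ℝ := fun x j => (vec x j : ℝ)
  have hmem : ∑ x with e x = k ∧ 0 < lam x, (lam x / (n + 2)) • pt x ∈
      convexHull ℝ (pt '' {x | e x = k ∧ 0 < lam x}) := by
    refine Convex.sum_mem (convex_convexHull ℝ _) (fun x _ => div_nonneg (ha x) hn.le) ?_ ?_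
    · rw [← Finset.sum_div, div_eq_one_iff_eq hn.ne', ← hb k]
      refine Finset.sum_subset (fun x hx => ?_) (fun x hx hx' => ?_)
      · simp only [Finset.mem_filter, Finset.mem_univ, true_and] at hx ⊢
        exact hx.1
      · simp only [Finset.mem_filter, Finset.mem_univ, true_and] at hx hx'
        rw [not_and] at hx'
        exact le_antisymm (not_lt.1 (hx' hx)) (ha x)
    · intro x hx
      simp only [Finset.mem_filter, Finset.mem_univ, true_and] at hx
      exact subset_convexHull ℝ _ ⟨x, hx, rfl⟩
  obtain ⟨ι', _, p, w, hr, hai, hw, hw1, hsum⟩ := eq_pos_convex_span_of_mem_convexHull hmem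
  have hcard : Fintype.card ι' ≤ n + 1 := by
    have h1 := hai.card_le_finrank_succ
    have h2 : Module.finrank ℝ (vectorSpan ℝ (Set.range p)) ≤ Module.finrank ℝ (Fin n → ℝ) :=
      Submodule.finrank_le _
    rw [Module.finrank_fin_fun] at h2
    omega
  have hg : ∀ i, ∃ x, (e x = k ∧ 0 < lam x) ∧ pt x = p i := by
    intro i
    obtain ⟨x, hx, he⟩ := hr ⟨i, rfl⟩
    exact ⟨x, hx, he⟩
  choose g hg1 hg2 using hg
  have key : ∀ φ : ι → ℝ, ∑ x, (∑ i, if g i = x then w i else 0) * φ x = ∑ i, w i * φ (g i) := by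
    intro φ
    simp only [Finset.sum_mul]
    rw [Finset.sum_comm]
    refine Finset.sum_congr rfl fun i _ => ?_
    simp
  have hnon : ∀ x, 0 ≤ ∑ i, if g i = x then w i else 0 := fun x =>
    Finset.sum_nonneg fun i _ => by split_ifs <;> simp [(hw i).le]
  refine ⟨fun x => (if e x = k then 0 else lam x) + ((n:ℝ) + 2) * ∑ i, if g i = x then w i else 0,
    ⟨?_, ?_, ?_⟩, ?_, ?_⟩
  · intro x
    have := mul_nonneg hn.le (hnon x)
    have := ha x
    dsimp only
    split_ifs <;> linarith
  · intro k'
    rw [Finset.sum_add_distrib, ← Finset.mul_sum]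
    have h1 := key fun x => if e x = k' then 1 else 0
    simp only [mul_ite, mul_one, mul_zero, (hg1 _).1] at h1
    rw [Finset.sum_filter, Finset.sum_filter, h1]
    by_cases hk : k = k'
    · subst hk
      simp only [if_true, hw1]
      rw [Finset.sum_eq_zero]
      · ring
      · intro x _; split_ifs <;> rfl
    · simp only [if_neg hk, Finset.sum_const_zero, mul_zero, add_zero]
      rw [← hb k', Finset.sum_filter]
      refine Finset.sum_congr rfl fun x _ => ?_
      split_ifs with h2 h3
      · exact absurd (h3.symm.trans h2) hk
      · rfl
      · rfl
  · intro j
    simp only [add_mul, mul_assoc, Finset.sum_add_distrib, ← Finset.mul_sum]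
    rw [key fun x => (vec x j : ℝ), ← hc j]
    have h1 := congrFun hsum j
    simp only [Finset.sum_apply, Pi.smul_apply, smul_eq_mul, ← hg2, pt] at h1
    rw [h1, ← add_mul, Finset.mul_sum, Finset.sum_filter, ← Finset.sum_add_distrib]
    refine Finset.sum_congr rfl fun x _ => ?_
    by_cases h2 : e x = k
    · rcases (ha x).eq_or_lt with h3 | h3
      · simp [← h3]
      · rw [if_pos h2, if_pos ⟨h2, h3⟩]
        field_simp
        ring
    · simp [h2]
  · intro x hx
    beta_reduce
    rw [hx, Finset.sum_eq_zero]
    · simp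
    · intro i _
      rw [if_neg]
      rintro rfl
      exact (hg1 i).2.ne' hx
  · have hne : (Finset.univ : Finset ι').Nonempty := by
      by_contra hcon
      rw [Finset.not_nonempty_iff_eq_empty] at hcon
      rw [hcon, Finset.sum_empty] at hw1
      exact zero_ne_one hw1
    obtain ⟨i, -, hi⟩ := Finset.exists_le_of_sum_le (s := Finset.univ)
      (f := fun _ : ι' => 1 / ((n:ℝ) + 1)) (g := w) hne (by
        rw [hw1, Finset.sum_const, nsmul_eq_mul, Finset.card_univ, mul_one_div,
          div_le_one (by positivity)]
        exact_mod_cast hcard)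
    refine ⟨g i, (hg1 i).1, ?_⟩
    have h1 : w i ≤ ∑ i', if g i' = g i then w i' else 0 := by
      have := Finset.single_le_sum (s := Finset.univ) (f := fun i' => if g i' = g i then w i' else 0)
        (fun i' _ => by split_ifs <;> simp [(hw i').le]) (Finset.mem_univ i)
      simpa using this
    simp only [(hg1 i).1, if_true, zero_add]
    have h2 : 1 / ((n:ℝ) + 1) ≤ ∑ i', if g i' = g i then w i' else 0 := hi.trans h1
    have h3 : ((n:ℝ)+2) * (1 / ((n:ℝ) + 1)) ≤ (n+2) * ∑ i', if g i' = g i then w i' else 0 :=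
      mul_le_mul_of_nonneg_left h2 hn.le
    refine lt_of_lt_of_le ?_ h3
    rw [mul_one_div, lt_div_iff₀ (by positivity)]
    linarith

theorem core_lemma {ι κ : Type*} [Fintype ι] [Fintype κ] {n : ℕ} (e : ι → κ)
    (vec : ι → Fin n → ℕ) (c : ι → ℝ) (z : (Fin n → ℕ) → WithTop ℝ)
    (h : ∃ lam I, Feas e vec lam I ∧ z I ≠ ⊤) :
    ∃ (a : Fin n → ℝ) (t : κ → ℝ), (∀ x, t (e x) ≤ c x + ∑ j, (vec x j : ℝ) * a j) ∧
      ∀ k, ∃ lam I x, Feas e vec lam I ∧ z I ≠ ⊤ ∧ e x = k ∧ 1 ≤ lam x ∧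
        c x + ∑ j, (vec x j : ℝ) * a j = t k ∧
        ∀ w, e w = k → ∀ I' : Fin n → ℕ, (∀ j, I' j + vec x j = I j + vec w j) →
          (c w : WithTop ℝ) + z I' ≤ (c x : WithTop ℝ) + z I →
          (c w : WithTop ℝ) + z I' = (c x : WithTop ℝ) + z I ∧
            c w + ∑ j, (vec w j : ℝ) * a j = t k := by
  obtain ⟨lam, I, hm, hmax⟩ := exists_feasMin_max e vec c z h
  obtain ⟨a, t, hat⟩ := feasMin_dual e vec c z lam I hm hmax
  refine ⟨a, t, fun x => (hat x).1, fun k => ?_⟩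
  have hcost : ∀ lam', Feas e vec lam' I → (∀ x, lam x = 0 → lam' x = 0) →
      ∑ x, lam' x * c x = ∑ x, lam' x * t (e x) - ∑ j, (I j : ℝ) * a j := by
    intro lam' hF hs
    have h1 : ∑ j, (I j : ℝ) * a j = ∑ x, lam' x * ∑ j, (vec x j : ℝ) * a j := by
      simp only [← hF.2.2, Finset.sum_mul, Finset.mul_sum]
      rw [Finset.sum_comm]
      simp only [mul_assoc]
    rw [h1, ← Finset.sum_sub_distrib]
    refine Finset.sum_congr rfl fun x _ => ?_
    rcases (hm.1.1 x).eq_or_lt with h2 | h2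
    · simp [hs x h2.symm]
    · rw [← ((hat x).2).1 h2]; ring
  have hfib : ∀ lam', Feas e vec lam' I → ∑ x, lam' x * t (e x) = ∑ k, ((n:ℝ) + 2) * t k := by
    intro lam' hF
    rw [← Finset.sum_fiberwise Finset.univ e]
    refine Finset.sum_congr rfl fun k _ => ?_
    rw [← hF.2.1 k, Finset.sum_mul]
    refine Finset.sum_congr rfl fun x hx => ?_
    rw [(Finset.mem_filter.1 hx).2]
  obtain ⟨lc, hlc, hsupp, x, hxk, hx1⟩ := feas_carath hm.1 k
  obtain ⟨ε, hε0, hε1, hεx⟩ : ∃ ε : ℝ, 0 < ε ∧ ε < 1 ∧ 1 < (1 - ε) * lc x + ε * lam x := by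
    have hA : 0 < lc x := by linarith
    refine ⟨(lc x - 1) / (2 * lc x), by apply div_pos <;> linarith, ?_, ?_⟩
    · rw [div_lt_one (by linarith)]; linarith
    · have h1 : (1 - (lc x - 1) / (2 * lc x)) * lc x = (lc x + 1) / 2 := by
        field_simp; ring
      have h2 : 0 ≤ (lc x - 1) / (2 * lc x) * lam x :=
        mul_nonneg (div_nonneg (by linarith) (by linarith)) (hm.1.1 x)
      rw [h1]; linarith
  obtain ⟨l, hl⟩ : ∃ l : ι → ℝ, ∀ y, l y = (1 - ε) * lc y + ε * lam y := ⟨_, fun y => rfl⟩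
  have hlF : Feas e vec l I := by
    refine ⟨fun y => ?_, fun k => ?_, fun j => ?_⟩
    · rw [hl]
      exact add_nonneg (mul_nonneg (by linarith) (hlc.1 y)) (mul_nonneg hε0.le (hm.1.1 y))
    · simp only [hl]
      rw [Finset.sum_add_distrib, ← Finset.mul_sum, ← Finset.mul_sum, hlc.2.1, hm.1.2.1]
      ring
    · simp only [hl, add_mul, mul_assoc]
      rw [Finset.sum_add_distrib, ← Finset.mul_sum, ← Finset.mul_sum, hlc.2.2, hm.1.2.2]
      ring
  have hl0 : ∀ y, lam y = 0 → l y = 0 := by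
    intro y hy; rw [hl, hy, hsupp y hy]; ring
  have hlpos : ∀ y, 0 < lam y → 0 < l y := by
    intro y hy
    rw [hl]
    exact add_pos_of_nonneg_of_pos (mul_nonneg (by linarith) (hlc.1 y)) (mul_pos hε0 hy)
  have hlcost : ∑ y, l y * c y = ∑ y, lam y * c y := by
    rw [hcost l hlF hl0, hcost lam hm.1 (fun _ h => h), hfib l hlF, hfib lam hm.1]
  have hlx : 1 < l x := by rw [hl]; exact hεx
  have hlamx : 0 < lam x := by
    rcases (hm.1.1 x).eq_or_lt with h2 | h2
    · have := hl0 x h2.symm; linarith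
    · exact h2
  refine ⟨l, I, x, hlF, hm.2.1, hxk, hlx.le, ?_, ?_⟩
  · rw [← hxk]; exact ((hat x).2).1 hlamx
  intro w hw I' hI' hle
  obtain ⟨zI, hzI⟩ := WithTop.ne_top_iff_exists.1 hm.2.1
  have hzI'ne : z I' ≠ ⊤ := by
    have : (c w : WithTop ℝ) + z I' ≠ ⊤ := by
      refine ne_top_of_le_ne_top ?_ hle
      rw [← hzI, ← WithTop.coe_add]
      exact WithTop.coe_ne_top
    exact (WithTop.add_ne_top.1 this).2
  obtain ⟨zI', hzI'⟩ := WithTop.ne_top_iff_exists.1 hzI'ne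
  obtain ⟨l', hl'⟩ : ∃ l' : ι → ℝ, ∀ y, l' y = l y - (if y = x then 1 else 0)
    + (if y = w then 1 else 0) := ⟨_, fun y => rfl⟩
  have hsum' : ∀ φ : ι → ℝ, ∑ y, l' y * φ y = ∑ y, l y * φ y - φ x + φ w := by
    intro φ
    simp only [hl', add_mul, sub_mul, Finset.sum_add_distrib, Finset.sum_sub_distrib, ite_mul,
      one_mul, zero_mul, Finset.sum_ite_eq', Finset.mem_univ, if_true]
  have hF' : Feas e vec l' I' := by
    refine ⟨fun y => ?_, fun k' => ?_, fun j => ?_⟩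
    · rw [hl']
      have := hlF.1 y
      by_cases hy : y = x
      · subst hy
        simp only [if_true]
        split_ifs <;> linarith
      · simp only [if_neg hy]
        split_ifs <;> linarith
    · have h1 := hsum' fun y => if e y = k' then 1 else 0
      simp only [mul_ite, mul_one, mul_zero] at h1
      rw [← Finset.sum_filter, ← Finset.sum_filter, hlF.2.1, hxk, hw] at h1
      rw [h1]; ring
    · rw [hsum', hlF.2.2]
      have := hI' j
      have h2 : (I' j : ℝ) + vec x j = I j + vec w j := by exact_mod_cast this
      linarith
  have hcost' : ∑ y, l' y * c y = ∑ y, lam y * c y - c x + c w := by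
    rw [hsum', hlcost]
  have hopt := hm.2.2 l' I' hF' hzI'ne
  rw [hcost', ← hzI, ← hzI'] at hopt
  simp only [WithTop.untopD_coe] at hopt
  rw [← hzI, ← hzI'] at hle ⊢
  have hle2 : c w + zI' ≤ c x + zI := by exact_mod_cast hle
  have heq : c w + zI' = c x + zI := by linarith
  refine ⟨by exact_mod_cast heq, ?_⟩
  rw [← hw]
  apply ((hat w).2).1
  have hM : FeasMin e vec c z l' I' := by
    refine ⟨hF', hzI'ne, fun lam' I'' h1 h2 => ?_⟩
    have := hm.2.2 lam' I'' h1 h2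
    rw [hcost', ← hzI']
    rw [← hzI] at this
    simp only [WithTop.untopD_coe] at this ⊢
    linarith
  have hcard := hmax _ _ hM
  by_contra hcon
  have hlt : (Finset.univ.filter fun x => 0 < lam x).card <
      (Finset.univ.filter fun x => 0 < l' x).card := by
    apply Finset.card_lt_card
    rw [Finset.ssubset_iff_of_subset]
    · refine ⟨w, ?_, ?_⟩
      · simp only [Finset.mem_filter, Finset.mem_univ, true_and]
        rw [hl']
        have hwx : w ≠ x := by rintro rfl; exact hcon hlamx
        have := hlF.1 w
        simp only [if_neg hwx, if_true]
        linarith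
      · simpa using hcon
    · intro y hy
      simp only [Finset.mem_filter, Finset.mem_univ, true_and] at hy ⊢
      rw [hl']
      have := hlpos y hy
      by_cases hyx : y = x
      · subst hyx
        simp only [if_true]
        split_ifs <;> linarith
      · simp only [if_neg hyx]
        split_ifs <;> linarith
  omega

theorem geo_one (b s : ℕ) (hb : 4 ≤ b) :
    ∑ i ∈ Finset.range s, b ^ (i + 1) + 1 ≤ 2 * b ^ s := by
  induction s with
  | zero => simp
  | succ s ih =>
    rw [Finset.sum_range_succ, pow_succ]
    nlinarith [Nat.one_le_pow s b (by omega)]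

theorem geo_three (b s : ℕ) (hb : 4 ≤ b) :
    3 * ∑ i ∈ Finset.range s, b ^ (i + 1) ≤ 4 * b ^ s := by
  induction s with
  | zero => simp
  | succ s ih =>
    rw [Finset.sum_range_succ, pow_succ]
    nlinarith [Nat.one_le_pow s b (by omega)]

theorem geo_weight (b m : ℕ) (hb : 4 ≤ b) :
    ∑ s ∈ Finset.range (m + 1), b ^ (s + 1) * (m + 1 - s) ≤ 2 * b ^ (m + 1) := by
  induction m with
  | zero => simp; omega
  | succ m ih =>
    have h1 : ∑ s ∈ Finset.range (m + 1 + 1), b ^ (s + 1) * (m + 1 + 1 - s)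
        = ∑ s ∈ Finset.range (m + 1 + 1), b ^ (s + 1) * (m + 1 - s)
          + ∑ s ∈ Finset.range (m + 1 + 1), b ^ (s + 1) := by
      rw [← Finset.sum_add_distrib]
      refine Finset.sum_congr rfl fun s hs => ?_
      have := Finset.mem_range.1 hs
      have h2 : m + 1 + 1 - s = (m + 1 - s) + 1 := by omega
      rw [h2]; ring
    rw [h1, Finset.sum_range_succ (fun s => b ^ (s + 1) * (m + 1 - s)), Nat.sub_self, mul_zero,
      add_zero]
    have h3 := geo_three b (m + 1 + 1) hb
    have h4 : b ^ (m + 1 + 1) = b ^ (m + 1) * b := pow_succ _ _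
    nlinarith [Nat.one_le_pow (m + 1) b (by omega)]

theorem pot_exists (b m W σ : ℕ) (hb : 4 ≤ b) :
    ∃ u : ℕ → ℕ, u 0 = 0 ∧ Monotone u ∧ (∀ x, u x ≤ 2 * W * b ^ (m + 1)) ∧
      ∀ s ≤ m, (∀ x h, x + h + σ ≤ (m + 1 - s) * W → u x + b ^ (s + 1) * h ≤ u (x + h)) ∧
        (∀ x h, (m + 1 - s) * W ≤ x + σ → u (x + h) + h ≤ u x + 2 * b ^ s * h) := by
  refine ⟨fun x => ∑ s ∈ Finset.range (m + 1), b ^ (s + 1) * min x ((m + 1 - s) * W - σ),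
    by simp, ?_, ?_, ?_⟩
  · intro x x' h
    refine Finset.sum_le_sum fun s _ => Nat.mul_le_mul_left _ ?_
    exact min_le_min_right _ h
  · intro x
    calc _ ≤ ∑ s ∈ Finset.range (m + 1), b ^ (s + 1) * (m + 1 - s) * W := by
          refine Finset.sum_le_sum fun s _ => ?_
          rw [mul_assoc]
          exact Nat.mul_le_mul_left _ ((min_le_right _ _).trans (Nat.sub_le _ _))
      _ ≤ 2 * b ^ (m + 1) * W := by
          rw [← Finset.sum_mul]
          exact Nat.mul_le_mul_right _ (geo_weight b m hb)
      _ = _ := by ring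
  · intro s hs
    constructor
    · intro x h hx
      have h1 : ∑ s' ∈ Finset.range (m + 1), (b ^ (s' + 1) * min x ((m + 1 - s') * W - σ)
          + if s' = s then b ^ (s + 1) * h else 0)
          ≤ ∑ s' ∈ Finset.range (m + 1), b ^ (s' + 1) * min (x + h) ((m + 1 - s') * W - σ) := by
        refine Finset.sum_le_sum fun s' _ => ?_
        split_ifs with he
        · subst he
          rw [← mul_add]
          exact Nat.mul_le_mul_left _ (by omega)
        · rw [add_zero]
          exact Nat.mul_le_mul_left _ (by omega)
      rw [Finset.sum_add_distrib, Finset.sum_ite_eq', if_pos (Finset.mem_range.2 (by omega))] at h1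
      exact h1
    · intro x h hx
      have h1 : ∑ s' ∈ Finset.range (m + 1), b ^ (s' + 1) * min (x + h) ((m + 1 - s') * W - σ)
          ≤ ∑ s' ∈ Finset.range (m + 1), (b ^ (s' + 1) * min x ((m + 1 - s') * W - σ)
          + if s' < s then b ^ (s' + 1) * h else 0) := by
        refine Finset.sum_le_sum fun s' _ => ?_
        split_ifs with he
        · rw [← mul_add]
          exact Nat.mul_le_mul_left _ (by omega)
        · rw [add_zero]
          have : (m + 1 - s') * W ≤ (m + 1 - s) * W := Nat.mul_le_mul_right _ (by omega)
          exact Nat.mul_le_mul_left _ (by omega)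
      rw [Finset.sum_add_distrib, ← Finset.sum_filter] at h1
      have h2 : (Finset.range (m + 1)).filter (fun s' => s' < s) = Finset.range s := by
        ext i; simp only [Finset.mem_filter, Finset.mem_range]; omega
      rw [h2, ← Finset.sum_mul] at h1
      have h3 := Nat.mul_le_mul_right h (geo_one b s hb)
      rw [add_mul, one_mul] at h3
      beta_reduce
      omega

theorem bound_arith (n k d m : ℕ) (hk : 1 ≤ k) (hd : 1 ≤ d) :
    n * (2 * ((n + 2) * k * d + 2 * (d * ((n + 2) * k + 1))) * (4 * d) ^ (m + 1))
      + d * ((n + 2) * k + 1) + (n + 2) * k * d + d ≤ 2 * (n + 2) ^ 2 * k * (4 * d) ^ (m + 2) := by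
  obtain ⟨q, hq⟩ : ∃ q, q = (n + 2) * k := ⟨_, rfl⟩
  have hq2 : 2 ≤ q := by rw [hq]; nlinarith
  obtain ⟨P, hP⟩ : ∃ P, P = (4 * d) ^ (m + 1) := ⟨_, rfl⟩
  have hP1 : 1 ≤ P := by rw [hP]; exact Nat.one_le_pow _ _ (by omega)
  have hN : 2 * (n + 2) ^ 2 * k * (4 * d) ^ (m + 2) = 8 * (n + 2) * (q * d) * P := by
    rw [hP, hq]; ring
  rw [hN, ← hq, ← hP]
  have h1 : d ≤ q * d := by nlinarith
  have h2 : 2 * d ≤ q * d := by nlinarith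
  have h3 : q * d ≤ q * d * P := Nat.le_mul_of_pos_right _ hP1
  have h4 : n * (2 * (q * d + 2 * (d * (q + 1))) * P) ≤ n * (8 * (q * d) * P) := by
    refine Nat.mul_le_mul_left _ (Nat.mul_le_mul_right _ ?_)
    nlinarith
  nlinarith

/-- The chain of supports stabilizes. -/
theorem chain_stab {n k : ℕ} (B : ℕ → Finset (Fin n)) (K : ℕ → Finset (Fin k))
    (hB : ∀ s, B s ⊆ B (s + 1)) (hK : ∀ s, K s ⊆ K (s + 1))
    (hBK : ∀ s, B s = B (s + 1) → K s = K (s + 1)) :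
    ∃ s ≤ min n k, K s = K (s + 1) := by
  by_contra hcon
  push Not at hcon
  have h1 : ∀ s, s ≤ min n k + 1 → s ≤ (B s).card ∧ s ≤ (K s).card := by
    intro s
    induction s with
    | zero => intro _; simp
    | succ s ih =>
      intro hs
      have h2 := ih (by omega)
      have h3 := hcon s (by omega)
      have h4 : (K s).card < (K (s + 1)).card :=
        Finset.card_lt_card ((hK s).ssubset_of_ne h3)
      have h5 : (B s).card < (B (s + 1)).card :=
        Finset.card_lt_card ((hB s).ssubset_of_ne fun h => h3 (hBK s h))
      omega
  have h2 := h1 (min n k + 1) le_rfl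
  have h3 := Finset.card_le_univ (B (min n k + 1))
  have h4 := Finset.card_le_univ (K (min n k + 1))
  rw [Fintype.card_fin] at h3 h4
  omega

theorem Feas.degree_le {ι κ : Type*} [Fintype ι] [Fintype κ] {n : ℕ} {e : ι → κ}
    {vec : ι → Fin n → ℕ} {lam : ι → ℝ} {I : Fin n → ℕ} (h : Feas e vec lam I) (d : ℕ)
    (hd : ∀ x, ∑ j, vec x j ≤ d) : ∑ j, I j ≤ (n + 2) * Fintype.card κ * d := by
  have h1 : ((∑ j, I j : ℕ) : ℝ) ≤ (n + 2) * Fintype.card κ * d := by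
    push_cast
    calc ∑ j, (I j : ℝ) = ∑ x, lam x * ((∑ j, vec x j : ℕ) : ℝ) := by
          simp only [← h.2.2]
          rw [Finset.sum_comm]
          push_cast
          simp only [Finset.mul_sum]
      _ ≤ ∑ x, lam x * d := Finset.sum_le_sum fun x _ =>
          mul_le_mul_of_nonneg_left (by exact_mod_cast hd x) (h.1 x)
      _ = (∑ x, lam x) * d := by rw [Finset.sum_mul]
      _ = (n + 2) * Fintype.card κ * d := by
          rw [← Finset.sum_fiberwise Finset.univ e]
          simp only [h.2.1, Finset.sum_const, Finset.card_univ, nsmul_eq_mul]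
          ring
  exact_mod_cast h1

theorem Feas.vec_le {ι κ : Type*} [Fintype ι] {n : ℕ} {e : ι → κ}
    {vec : ι → Fin n → ℕ} {lam : ι → ℝ} {I : Fin n → ℕ} (h : Feas e vec lam I) (x : ι)
    (hx : 1 ≤ lam x) (j : Fin n) : vec x j ≤ I j := by
  have h1 : (vec x j : ℝ) ≤ I j := by
    rw [← h.2.2 j]
    have h2 := Finset.single_le_sum (s := Finset.univ) (f := fun x => lam x * (vec x j : ℝ))
      (fun y _ => mul_nonneg (h.1 y) (by positivity)) (Finset.mem_univ x)
    refine le_trans ?_ h2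
    exact le_mul_of_one_le_left (by positivity) hx
  exact_mod_cast h1

theorem Feas.zero_off {ι κ : Type*} [Fintype ι] {n : ℕ} {e : ι → κ}
    {vec : ι → Fin n → ℕ} {lam : ι → ℝ} {I : Fin n → ℕ} (h : Feas e vec lam I) (j : Fin n)
    (hj : ∀ x, vec x j = 0) : I j = 0 := by
  have := h.2.2 j
  simp only [hj, Nat.cast_zero, mul_zero, Finset.sum_const_zero] at this
  exact_mod_cast this.symm

theorem Feas.exchange {ι κ : Type*} [Fintype ι] {n : ℕ} {e : ι → κ}
    {vec : ι → Fin n → ℕ} {lam : ι → ℝ} {I : Fin n → ℕ} (h : Feas e vec lam I) (x w : ι)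
    (hx : 1 ≤ lam x) (hw : e w = e x) (I' : Fin n → ℕ)
    (hI' : ∀ j, I' j + vec x j = I j + vec w j) : ∃ lam', Feas e vec lam' I' := by
  obtain ⟨l', hl'⟩ : ∃ l' : ι → ℝ, ∀ y, l' y = lam y - (if y = x then 1 else 0)
    + (if y = w then 1 else 0) := ⟨_, fun y => rfl⟩
  have hsum' : ∀ φ : ι → ℝ, ∑ y, l' y * φ y = ∑ y, lam y * φ y - φ x + φ w := by
    intro φ
    simp only [hl', add_mul, sub_mul, Finset.sum_add_distrib, Finset.sum_sub_distrib, ite_mul,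
      one_mul, zero_mul, Finset.sum_ite_eq', Finset.mem_univ, if_true]
  refine ⟨l', fun y => ?_, fun k' => ?_, fun j => ?_⟩
  · rw [hl']
    have := h.1 y
    by_cases hy : y = x
    · subst hy
      simp only [if_true]
      split_ifs <;> linarith
    · simp only [if_neg hy]
      split_ifs <;> linarith
  · have h1 := hsum' fun y => if e y = k' then 1 else 0
    simp only [mul_ite, mul_one, mul_zero] at h1
    rw [← Finset.sum_filter, ← Finset.sum_filter, h.2.1, hw] at h1
    rw [h1]; ring
  · rw [hsum', h.2.2]
    have := hI' j
    have h2 : (I' j : ℝ) + vec x j = I j + vec w j := by exact_mod_cast this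
    linarith

theorem Feas.init {ι κ : Type*} [Fintype ι] [Fintype κ] {n : ℕ} (e : ι → κ)
    (vec : ι → Fin n → ℕ) (x0 : κ → ι) (h0 : ∀ k, e (x0 k) = k) :
    ∃ lam, Feas e vec lam (fun j => ∑ k, (n + 2) * vec (x0 k) j) := by
  have key : ∀ φ : ι → ℝ, ∑ y, (if y = x0 (e y) then (n:ℝ) + 2 else 0) * φ y
      = ∑ k, ((n:ℝ) + 2) * φ (x0 k) := by
    intro φ
    rw [← Finset.sum_fiberwise Finset.univ e]
    refine Finset.sum_congr rfl fun k _ => ?_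
    rw [Finset.sum_eq_single (x0 k)]
    · simp [h0]
    · intro y hy hne
      rw [(Finset.mem_filter.1 hy).2, if_neg hne, zero_mul]
    · intro h
      simp [h0] at h
  refine ⟨fun y => if y = x0 (e y) then (n:ℝ) + 2 else 0, fun y => ?_, fun k => ?_, fun j => ?_⟩
  · dsimp only; split_ifs <;> positivity
  · have h1 := key fun y => if e y = k then 1 else 0
    simp only [mul_ite, mul_one, mul_zero, h0] at h1
    rw [Finset.sum_filter, h1]
    simp
  · rw [key fun y => (vec y j : ℝ)]
    push_cast
    rfl

theorem pot_gain {n : ℕ} (d m s D T W : ℕ) (u : ℕ → ℕ) (hmono : Monotone u) (hDT : D < d * T)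
    (hW : W = D + 2 * (d * T)) (hs : s ≤ m)
    (hu1 : ∀ x h, x + h + (d * T + D) ≤ (m + 1 - s) * W →
      u x + (4 * d) ^ (s + 1) * h ≤ u (x + h))
    (hu2 : ∀ x h, (m + 1 - s) * W ≤ x + (d * T + D) → u (x + h) + h ≤ u x + 2 * (4 * d) ^ s * h)
    (Js J I r l : Fin n → ℕ) (Bs Bn : Finset (Fin n)) (hsub : Bs ⊆ Bn)
    (hBs : ∀ j ∈ Bs, (m + 1 - s) * W ≤ Js j) (hBn : ∀ j ∉ Bn, Js j + W ≤ (m + 1 - s) * W)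
    (hI : ∀ j ∉ Bn, I j = 0) (hID : ∑ j, I j ≤ D) (hr0 : ∀ j ∉ Bs, r j = 0)
    (hl0 : ∀ j ∉ Bs, l j = 0) (hJ1 : ∀ j ∉ Bs, Js j ≤ J j) (hJ2 : ∀ j, Js j ≤ J j + r j + l j)
    (hl : ∑ j, l j ≤ d * T) (hr : ∑ j, r j ≤ D) (hJ : ∑ j, J j + ∑ j, r j ≤ ∑ j, Js j + d * T)
    (hgain : T + ∑ j ∈ Bnᶜ, Js j ≤ ∑ j ∈ Bnᶜ, J j) (hup : ∀ j ∉ Bn, J j ≤ Js j + d * T) :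
    ∑ j, u (Js j) + ∑ j, (J j + I j) < ∑ j, u (J j + I j) + ∑ j, Js j := by
  have hd : 1 ≤ d := by
    rcases Nat.eq_zero_or_pos d with h | h
    · subst h; simp at hDT
    · exact h
  have hpt : ∀ j, u (Js j) + (r j + l j) + (4 * d) ^ (s + 1) * (if j ∈ Bnᶜ then J j - Js j else 0)
      ≤ u (J j + I j) + 2 * (4 * d) ^ s * (r j + l j) := by
    intro j
    by_cases hj : j ∈ Bn
    · rw [if_neg (by simpa using hj), mul_zero, add_zero]
      by_cases hjs : j ∈ Bs
      · have h1 := hBs j hjs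
        have h2 : r j ≤ D := (Finset.single_le_sum (f := r) (fun _ _ => Nat.zero_le _)
          (Finset.mem_univ j)).trans hr
        have h3 : l j ≤ d * T := (Finset.single_le_sum (f := l) (fun _ _ => Nat.zero_le _)
          (Finset.mem_univ j)).trans hl
        have h4 : W ≤ (m + 1 - s) * W := Nat.le_mul_of_pos_left _ (by omega)
        have h5 := hu2 (Js j - (r j + l j)) (r j + l j) (by omega)
        have h6 : Js j - (r j + l j) + (r j + l j) = Js j := by omega
        rw [h6] at h5
        have h7 := hJ2 j
        have h8 : u (Js j - (r j + l j)) ≤ u (J j + I j) := hmono (by omega)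
        omega
      · rw [hr0 j hjs, hl0 j hjs]
        have h1 := hJ1 j hjs
        have h8 : u (Js j) ≤ u (J j + I j) := hmono (by omega)
        omega
    · have hjs : j ∉ Bs := fun h => hj (hsub h)
      rw [if_pos (by simpa using hj), hr0 j hjs, hl0 j hjs, hI j hj]
      have h1 := hJ1 j hjs
      have h2 := hup j hj
      have h3 := hBn j hj
      have h4 := hu1 (Js j) (J j - Js j) (by omega)
      have h5 : Js j + (J j - Js j) = J j := by omega
      rw [h5] at h4
      simpa using h4
  have hsum := Finset.sum_le_sum (s := Finset.univ) fun j _ => hpt j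
  simp only [Finset.sum_add_distrib, ← Finset.mul_sum] at hsum
  rw [← Finset.sum_filter] at hsum
  have hX : T ≤ ∑ j with j ∈ Bnᶜ, (J j - Js j) := by
    have h1 : (Finset.univ.filter fun j => j ∈ Bnᶜ) = Bnᶜ := by ext j; simp
    rw [h1]
    have h2 : ∑ j ∈ Bnᶜ, J j = ∑ j ∈ Bnᶜ, (J j - Js j) + ∑ j ∈ Bnᶜ, Js j := by
      rw [← Finset.sum_add_distrib]
      refine Finset.sum_congr rfl fun j hj => ?_
      have := hJ1 j fun h => (Finset.mem_compl.1 hj) (hsub h)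
      omega
    omega
  obtain ⟨X, hXd⟩ : ∃ X, X = ∑ j with j ∈ Bnᶜ, (J j - Js j) := ⟨_, rfl⟩
  rw [← hXd] at hsum hX
  rw [Finset.sum_add_distrib]
  obtain ⟨P, hP⟩ : ∃ P, P = (4 * d) ^ s := ⟨_, rfl⟩
  have hP1 : 1 ≤ P := by rw [hP]; exact Nat.one_le_pow _ _ (by omega)
  rw [pow_succ, ← hP] at hsum
  have h1 : P * (4 * d) * T ≤ P * (4 * d) * X := Nat.mul_le_mul_left _ hX
  obtain ⟨R, hR⟩ : ∃ R, R + (∑ j, r j + ∑ j, l j) = d * T + D := ⟨_, Nat.sub_add_cancel (by omega)⟩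
  have h2 : R ≤ 2 * P * R := Nat.le_mul_of_pos_left _ (by omega)
  have h3 : 2 * P * R + 2 * P * (∑ j, r j + ∑ j, l j) = 2 * P * (d * T + D) := by
    rw [← mul_add, hR]
  have h4 : 2 * P * (d * T + D) < 2 * P * (2 * (d * T)) :=
    Nat.mul_lt_mul_of_pos_left (by omega) (by omega)
  have h5 : P * (4 * d) * T = 2 * P * (2 * (d * T)) := by ring
  omega

theorem TropPoly.monoT_off {n : ℕ} (p : TropPoly n) (B : Finset (Fin n)) (a : Fin n → ℝ)
    (v : Exp n) (hv : ∃ j, j ∉ B ∧ v j ≠ 0) :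
    p.monoT v (fun j => if j ∈ B then (a j : WithTop ℝ) else ⊤) = ⊤ := by
  obtain ⟨j, hj, hne⟩ := hv
  have h1 : ∑ j, (v j) • (if j ∈ B then (a j : WithTop ℝ) else ⊤) = ⊤ := by
    rw [WithTop.sum_eq_top]
    refine ⟨j, Finset.mem_univ _, ?_⟩
    rw [if_neg hj]
    obtain ⟨k, hk⟩ := Nat.exists_eq_succ_of_ne_zero hne
    rw [hk, succ_nsmul]
    simp
  unfold TropPoly.monoT
  rw [h1]; simp

theorem TropPoly.monoT_on {n : ℕ} (p : TropPoly n) (B : Finset (Fin n)) (a : Fin n → ℝ)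
    (v : Exp n) (hv : ∀ j, j ∉ B → v j = 0) :
    p.monoT v (fun j => if j ∈ B then (a j : WithTop ℝ) else ⊤) =
      ((p.coeff v + ∑ j, (v j : ℝ) * a j : ℝ) : WithTop ℝ) := by
  unfold TropPoly.monoT
  rw [WithTop.coe_add, WithTop.coe_sum]
  congr 1
  refine Finset.sum_congr rfl fun j _ => ?_
  by_cases hj : j ∈ B
  · beta_reduce
    rw [if_pos hj, ← WithTop.coe_nsmul, nsmul_eq_mul]
  · rw [hv j hj]; simp

theorem TropPoly.evalT_off {n : ℕ} (p : TropPoly n) (B : Finset (Fin n)) (a : Fin n → ℝ)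
    (hv : ∀ v ∈ p.supp, ∃ j, j ∉ B ∧ v j ≠ 0) :
    p.evalT (fun j => if j ∈ B then (a j : WithTop ℝ) else ⊤) = ⊤ := by
  unfold TropPoly.evalT
  rw [eq_top_iff]
  refine Finset.le_inf fun v h => ?_
  rw [p.monoT_off B a v (hv v h)]

theorem TropPoly.evalT_on {n : ℕ} (p : TropPoly n) (B : Finset (Fin n)) (a : Fin n → ℝ) (t : ℝ)
    (h1 : ∀ v ∈ p.supp, (∀ j, j ∉ B → v j = 0) → t ≤ p.coeff v + ∑ j, (v j : ℝ) * a j)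
    (h2 : ∃ v ∈ p.supp, (∀ j, j ∉ B → v j = 0) ∧ p.coeff v + ∑ j, (v j : ℝ) * a j = t) :
    p.evalT (fun j => if j ∈ B then (a j : WithTop ℝ) else ⊤) = (t : WithTop ℝ) := by
  unfold TropPoly.evalT
  apply le_antisymm
  · obtain ⟨v, hv, hs, he⟩ := h2
    refine (Finset.inf_le hv).trans ?_
    rw [p.monoT_on B a v hs, he]
  · refine Finset.le_inf fun v hv => ?_
    by_cases hs : ∀ j, j ∉ B → v j = 0
    · rw [p.monoT_on B a v hs]
      exact WithTop.coe_le_coe.2 (h1 v hv hs)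
    · push Not at hs
      rw [p.monoT_off B a v hs]
      exact le_top

set_option maxHeartbeats 1000000 in
theorem dual_null {n k d : ℕ} (hk : 1 ≤ k) (hd : 1 ≤ d) (G : Fin k → Bool → TropPoly n)
    (hdeg : ∀ i b, ∀ v ∈ (G i b).supp, ∑ j, v j ≤ d) (y : Exp n → WithTop ℝ) (hy0 : y 0 ≠ ⊤)
    (N : ℕ) (hN : N = 2 * (n + 2) ^ 2 * k * (4 * d) ^ (min n k + 2))
    (hmac : ∀ i b (J : Exp n), ∑ j, J j + d ≤ N → ∀ v ∈ (G i b).supp, ∃ w ∈ (G i !b).supp,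
      (((G i !b).coeff w : ℝ) : WithTop ℝ) + y (J + w) ≤
        (((G i b).coeff v : ℝ) : WithTop ℝ) + y (J + v)) :
    ∃ a : Fin n → WithTop ℝ, ∀ i, (G i true).evalT a = (G i false).evalT a := by
  obtain ⟨m, hm⟩ : ∃ m, m = min n k := ⟨_, rfl⟩
  obtain ⟨D, hD⟩ : ∃ D, D = (n + 2) * k * d := ⟨_, rfl⟩
  obtain ⟨T, hT⟩ : ∃ T, T = (n + 2) * k + 1 := ⟨_, rfl⟩
  obtain ⟨W, hW⟩ : ∃ W, W = D + 2 * (d * T) := ⟨_, rfl⟩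
  have hDT : D + d = d * T := by rw [hD, hT]; ring
  have hNb : n * (2 * W * (4 * d) ^ (m + 1)) + d * T + D + d ≤ N := by
    have := bound_arith n k d m hk hd
    rw [hN, hW, hD, hT, ← hm]; exact this
  obtain ⟨u, hu0, hmono, hubd, hus⟩ := pot_exists (4 * d) m W (d * T + D) (by omega)
  have hfin : {J : Exp n | ∑ j, J j ≤ N ∧ y J ≠ ⊤}.Finite := by
    refine (Set.finite_Iic (fun _ => N : Fin n → ℕ)).subset ?_
    rintro J ⟨hJ, -⟩ j
    exact (Finset.single_le_sum (f := J) (fun _ _ => Nat.zero_le _) (Finset.mem_univ j)).trans hJ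
  obtain ⟨Js, ⟨hJsN, hJsy⟩, hJsmax⟩ := Set.exists_max_image _
    (fun J : Exp n => ((∑ j, u (J j) : ℕ) : ℤ) - ((∑ j, J j : ℕ) : ℤ)) hfin
    ⟨0, by simp, hy0⟩
  have hJsR : ∑ j, Js j ≤ n * (2 * W * (4 * d) ^ (m + 1)) := by
    have h1 := hJsmax 0 ⟨by simp, hy0⟩
    simp only [Pi.zero_apply, hu0, Finset.sum_const_zero, Nat.cast_zero, sub_zero] at h1
    have h2 : ∑ j, u (Js j) ≤ ∑ _j : Fin n, 2 * W * (4 * d) ^ (m + 1) :=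
      Finset.sum_le_sum fun j _ => hubd _
    rw [Finset.sum_const, Finset.card_univ, Fintype.card_fin, smul_eq_mul] at h2
    omega
  obtain ⟨s, hsm, hKs⟩ := chain_stab
    (fun s => Finset.univ.filter fun j : Fin n => (m + 1 - s) * W ≤ Js j)
    (fun s => Finset.univ.filter fun i : Fin k => ∃ b, ∃ v ∈ (G i b).supp,
      ∀ j, j ∉ (Finset.univ.filter fun j : Fin n => (m + 1 - s) * W ≤ Js j) → v j = 0)
    (by
      intro s j hj
      simp only [Finset.mem_filter, Finset.mem_univ, true_and] at hj ⊢
      exact le_trans (Nat.mul_le_mul_right _ (by omega)) hj)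
    (by
      intro s i hi
      simp only [Finset.mem_filter, Finset.mem_univ, true_and] at hi ⊢
      obtain ⟨b, v, hv, h⟩ := hi
      refine ⟨b, v, hv, fun j hj => h j fun hj' => hj ?_⟩
      exact le_trans (Nat.mul_le_mul_right _ (by omega)) hj')
    (by
      intro s h
      beta_reduce at h ⊢
      rw [h])
  rw [← hm] at hsm
  beta_reduce at hKs
  obtain ⟨Bs, hBs⟩ : ∃ B, B = Finset.univ.filter fun j : Fin n => (m + 1 - s) * W ≤ Js j :=
    ⟨_, rfl⟩
  obtain ⟨Bn, hBn⟩ : ∃ B, B = Finset.univ.filter fun j : Fin n => (m + 1 - (s + 1)) * W ≤ Js j :=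
    ⟨_, rfl⟩
  rw [← hBs, ← hBn] at hKs
  obtain ⟨K, hK⟩ : ∃ K, K = Finset.univ.filter fun i : Fin k => ∃ b, ∃ v ∈ (G i b).supp,
      ∀ j, j ∉ Bn → v j = 0 := ⟨_, rfl⟩
  rw [← hK] at hKs
  have hsub : Bs ⊆ Bn := by
    intro j hj
    rw [hBs] at hj
    rw [hBn]
    simp only [Finset.mem_filter, Finset.mem_univ, true_and] at hj ⊢
    exact le_trans (Nat.mul_le_mul_right _ (by omega)) hj
  have hBsW : ∀ j ∈ Bs, (m + 1 - s) * W ≤ Js j := by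
    intro j hj; rw [hBs] at hj; simpa using hj
  have hW1 : W ≤ (m + 1 - s) * W := Nat.le_mul_of_pos_left _ (by omega)
  have hBnW : ∀ j ∉ Bn, Js j + W ≤ (m + 1 - s) * W := by
    intro j hj
    rw [hBn] at hj
    simp only [Finset.mem_filter, Finset.mem_univ, true_and, not_le] at hj
    have h1 : m + 1 - s = (m + 1 - (s + 1)) + 1 := by omega
    rw [h1, add_mul, one_mul]
    omega
  have hcP : ∀ i v, ∃ c : ℝ, (∀ b, v ∈ (G i b).supp → c ≤ (G i b).coeff v) ∧
      ((∃ b, v ∈ (G i b).supp) → ∃ b, v ∈ (G i b).supp ∧ (G i b).coeff v = c) := by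
    intro i v
    by_cases h : ∃ b, v ∈ (G i b).supp
    · obtain ⟨b, hb, hmin⟩ := Set.exists_min_image {b | v ∈ (G i b).supp}
        (fun b => (G i b).coeff v) (Set.toFinite _) h
      exact ⟨(G i b).coeff v, fun b' hb' => hmin b' hb', fun _ => ⟨b, hb, rfl⟩⟩
    · exact ⟨0, fun b hb => absurd ⟨b, hb⟩ h, fun h' => absurd h' h⟩
  choose cP hcP1 hcP2 using hcP
  let ι := Σ i : {i // i ∈ K}, {v : Exp n // v ∈ (((G i.1 true).supp ∪ (G i.1 false).supp).filter
    fun v => ∀ j, j ∉ Bn → v j = 0)}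
  let e : ι → {i // i ∈ K} := Sigma.fst
  let vec : ι → Fin n → ℕ := fun x => x.2.1
  have hι : ∀ x : ι, (∃ b, x.2.1 ∈ (G x.1.1 b).supp) ∧ ∀ j, j ∉ Bn → vec x j = 0 := by
    rintro ⟨i, v, hv⟩
    simp only [Finset.mem_filter, Finset.mem_union] at hv
    refine ⟨?_, hv.2⟩
    rcases hv.1 with h | h
    · exact ⟨true, h⟩
    · exact ⟨false, h⟩
  have mkι : ∀ (i : {i // i ∈ K}) (v : Exp n) (b : Bool), v ∈ (G i.1 b).supp →
      (∀ j, j ∉ Bn → v j = 0) → ∃ x : ι, x.1 = i ∧ x.2.1 = v := by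
    intro i v b hv hs
    refine ⟨⟨i, v, ?_⟩, rfl, rfl⟩
    simp only [Finset.mem_filter, Finset.mem_union]
    refine ⟨?_, hs⟩
    cases b
    · exact Or.inr hv
    · exact Or.inl hv
  have hvd : ∀ x : ι, ∑ j, vec x j ≤ d := by
    intro x
    obtain ⟨⟨b, hb⟩, -⟩ := hι x
    exact hdeg _ _ _ hb
  have hcardK : Fintype.card {i // i ∈ K} ≤ k := by
    rw [Fintype.card_coe]
    have := Finset.card_le_univ K
    rwa [Fintype.card_fin] at this
  have hID : ∀ lam I, Feas e vec lam I → ∑ j, I j ≤ D := by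
    intro lam I hF
    refine (hF.degree_le d hvd).trans ?_
    rw [hD]
    exact Nat.mul_le_mul_right _ (Nat.mul_le_mul_left _ hcardK)
  have hI0 : ∀ lam I, Feas e vec lam I → ∀ j, j ∉ Bn → I j = 0 := by
    intro lam I hF j hj
    exact hF.zero_off j fun x => (hι x).2 j hj
  have hx0 : ∀ i : {i // i ∈ K}, ∃ x : ι, e x = i ∧ ∀ j, j ∉ Bs → vec x j = 0 := by
    rintro ⟨i, hi⟩
    have hi' := hi
    rw [← hKs] at hi'
    simp only [Finset.mem_filter, Finset.mem_univ, true_and] at hi'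
    obtain ⟨b, v, hv, hs⟩ := hi'
    obtain ⟨x, h1, h2⟩ := mkι ⟨i, hi⟩ v b hv fun j hj => hs j fun h => hj (hsub h)
    refine ⟨x, h1, ?_⟩
    simp only [vec, h2]
    exact hs
  choose x0 hx0e hx0s using hx0
  obtain ⟨lam0, hlam0⟩ := Feas.init e vec x0 hx0e
  obtain ⟨r, hr⟩ : ∃ r : Fin n → ℕ, r = fun j => ∑ i, (n + 2) * vec (x0 i) j := ⟨_, rfl⟩
  rw [← hr] at hlam0
  have hrD : ∑ j, r j ≤ D := hID _ _ hlam0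
  have hr0 : ∀ j, j ∉ Bs → r j = 0 := by
    intro j hj
    rw [hr]
    simp only [hx0s _ j hj, mul_zero, Finset.sum_const_zero]
  have hrj : ∀ j, r j ≤ D := fun j =>
    (Finset.single_le_sum (f := r) (fun _ _ => Nat.zero_le _) (Finset.mem_univ j)).trans hrD
  let Q : ℕ → (Fin n → ℕ) → (Fin n → ℕ) → Prop := fun τ J l =>
    (∀ j, j ∉ Bs → l j = 0) ∧ (∀ j, j ∉ Bs → Js j ≤ J j) ∧ (∀ j, Js j ≤ J j + r j + l j) ∧
    ∑ j, l j ≤ d * τ ∧ ∑ j, J j + ∑ j, r j ≤ ∑ j, Js j + d * τ ∧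
    τ + ∑ j ∈ Bnᶜ, Js j ≤ ∑ j ∈ Bnᶜ, J j ∧ ∀ j, j ∉ Bn → J j ≤ Js j + d * τ
  let Pr : ℕ → Prop := fun τ => ∃ J l, Q τ J l ∧ ∃ lam I, Feas e vec lam I ∧ y (J + I) ≠ ⊤
  have hrJs : ∀ j, r j ≤ Js j := by
    intro j
    by_cases hj : j ∈ Bs
    · have := hBsW j hj
      have := hrj j
      omega
    · rw [hr0 j hj]; exact Nat.zero_le _
  have hP0 : Pr 0 := by
    refine ⟨fun j => Js j - r j, fun _ => 0, ⟨fun _ _ => rfl, ?_, ?_, by simp, ?_, ?_, ?_⟩,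
      lam0, r, hlam0, ?_⟩
    · intro j hj; simp [hr0 j hj]
    · intro j; have := hrJs j; beta_reduce; omega
    · rw [← Finset.sum_add_distrib]
      refine (Finset.sum_le_sum fun j _ => ?_).trans (Nat.le_add_right _ _)
      have := hrJs j; omega
    · rw [zero_add]
      refine Finset.sum_le_sum fun j hj => ?_
      rw [hr0 j fun h => (Finset.mem_compl.1 hj) (hsub h)]
      simp
    · intro j _; beta_reduce; omega
    · have : (fun j => Js j - r j) + r = Js := by
        funext j; have := hrJs j; simp only [Pi.add_apply]; omega
      rw [this]; exact hJsy
  have hPT : ¬ Pr T := by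
    rintro ⟨J, l, ⟨q1, q2, q3, q4, q5, q6, q7⟩, lam, I, hF, hy⟩
    have hlt := pot_gain d m s D T W u hmono (by omega) hW hsm (hus s hsm).1 (hus s hsm).2
      Js J I r l Bs Bn hsub hBsW hBnW (hI0 _ _ hF) (hID _ _ hF) hr0 q1 q2 q3 q4 hrD q5 q6 q7
    have hle := hJsmax (J + I) ⟨by
      have h1 := hID _ _ hF
      have h2 : ∑ j, (J + I) j = ∑ j, J j + ∑ j, I j := by
        simp only [Pi.add_apply, Finset.sum_add_distrib]
      rw [h2]
      omega, hy⟩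
    simp only [Pi.add_apply] at hle
    omega
  obtain ⟨τ, hτT, hPτ, hPτ'⟩ : ∃ τ, τ < T ∧ Pr τ ∧ ¬ Pr (τ + 1) := by
    by_contra hcon
    push Not at hcon
    have : ∀ τ, τ ≤ T → Pr τ := by
      intro τ
      induction τ with
      | zero => intro _; exact hP0
      | succ τ ih => intro h; exact hcon τ (by omega) (ih (by omega))
    exact hPT (this T le_rfl)
  obtain ⟨J, l, hQ, hfeas⟩ := hPτ
  obtain ⟨q1, q2, q3, q4, q5, q6, q7⟩ := hQ
  have hdτ : d * τ + d ≤ d * T := by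
    have := Nat.mul_le_mul_left d (show τ + 1 ≤ T by omega)
    rw [mul_add, mul_one] at this
    exact this
  obtain ⟨a, t, hat, hcore⟩ := core_lemma e vec (fun x : ι => cP x.1.1 x.2.1)
    (fun I => y (J + I)) hfeas
  refine ⟨fun j => if j ∈ Bn then (a j : WithTop ℝ) else ⊤, fun i => ?_⟩
  by_cases hi : i ∈ K
  swap
  · have hoff : ∀ b, (G i b).evalT (fun j => if j ∈ Bn then (a j : WithTop ℝ) else ⊤) = ⊤ := by
      intro b
      refine (G i b).evalT_off Bn a fun v hv => ?_
      by_contra hcon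
      push Not at hcon
      apply hi
      rw [hK]
      simp only [Finset.mem_filter, Finset.mem_univ, true_and]
      exact ⟨b, v, hv, hcon⟩
    rw [hoff, hoff]
  have hlow : ∀ b, ∀ v ∈ (G i b).supp, (∀ j, j ∉ Bn → v j = 0) →
      t ⟨i, hi⟩ ≤ (G i b).coeff v + ∑ j, (v j : ℝ) * a j := by
    intro b v hv hs
    obtain ⟨x, h1, h2⟩ := mkι ⟨i, hi⟩ v b hv hs
    have h3 := hat x
    simp only [e, vec, h1, h2] at h3
    have h4 := hcP1 i v b hv
    linarith
  have hatt : ∀ b, ∃ v ∈ (G i b).supp, (∀ j, j ∉ Bn → v j = 0) ∧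
      (G i b).coeff v + ∑ j, (v j : ℝ) * a j = t ⟨i, hi⟩ := by
    obtain ⟨lam, I, x, hF, hyI, hxe, hx1, hxt, hxw⟩ := hcore ⟨i, hi⟩
    beta_reduce at hyI hxw
    have hxi : x.1.1 = i := congrArg Subtype.val hxe
    obtain ⟨b0, hb0, hb0c⟩ := hcP2 x.1.1 x.2.1 (hι x).1
    have hgen : ∀ i', x.1.1 = i' → x.2.1 ∈ (G i' b0).supp ∧ (G i' b0).coeff x.2.1 = cP i' x.2.1 ∧
        cP x.1.1 x.2.1 = cP i' x.2.1 := by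
      rintro _ rfl
      exact ⟨hb0, hb0c, rfl⟩
    obtain ⟨hb0, hb0c, hcx⟩ := hgen i hxi
    rw [hcx] at hxt
    simp only [hcx] at hxw
    have hxI : ∀ j, vec x j ≤ I j := hF.vec_le x hx1
    have h1 : ∃ v ∈ (G i b0).supp, (∀ j, j ∉ Bn → v j = 0) ∧
        (G i b0).coeff v + ∑ j, (v j : ℝ) * a j = t ⟨i, hi⟩ :=
      ⟨x.2.1, hb0, (hι x).2, by rw [hb0c]; exact hxt⟩
    have hrow : ∑ j, (J j + (I j - vec x j)) + d ≤ N := by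
      have h2 : ∑ j, (J j + (I j - vec x j)) ≤ ∑ j, J j + ∑ j, I j := by
        rw [← Finset.sum_add_distrib]
        exact Finset.sum_le_sum fun j _ => by omega
      have h3 := hID _ _ hF
      omega
    obtain ⟨w, hw, hwle⟩ := hmac i b0 (fun j => J j + (I j - vec x j)) hrow x.2.1 hb0
    have hJI : (fun j => J j + (I j - vec x j)) + x.2.1 = J + I := by
      funext j
      have := hxI j
      simp only [vec] at this
      simp only [Pi.add_apply, vec]
      omega
    rw [hJI, hb0c] at hwle
    have hwfin : y ((fun j => J j + (I j - vec x j)) + w) ≠ ⊤ := by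
      have h2 : (cP i x.2.1 : WithTop ℝ) + y (J + I) ≠ ⊤ :=
        WithTop.add_ne_top.2 ⟨WithTop.coe_ne_top, hyI⟩
      exact (WithTop.add_ne_top.1 (ne_top_of_le_ne_top h2 hwle)).2
    have hws : ∀ j, j ∉ Bn → w j = 0 := by
      by_contra hcon
      push Not at hcon
      obtain ⟨j0, hj0, hj0w⟩ := hcon
      apply hPτ'
      obtain ⟨v0, hv0⟩ : ∃ v0, v0 = vec (x0 ⟨i, hi⟩) := ⟨_, rfl⟩
      have hv0s : ∀ j, j ∉ Bs → v0 j = 0 := by rw [hv0]; exact hx0s _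
      have hv0d : ∑ j, v0 j ≤ d := by rw [hv0]; exact hvd _
      have hwd : ∑ j, w j ≤ d := hdeg _ _ _ hw
      have hv0J : ∀ j, v0 j ≤ J j := by
        intro j
        by_cases hj : j ∈ Bs
        · have h2 := hBsW j hj
          have h3 := hrj j
          have h4 := q3 j
          have h5 : l j ≤ d * τ := (Finset.single_le_sum (f := l) (fun _ _ => Nat.zero_le _)
            (Finset.mem_univ j)).trans q4
          have h6 : v0 j ≤ d := (Finset.single_le_sum (f := v0) (fun _ _ => Nat.zero_le _)
            (Finset.mem_univ j)).trans hv0d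
          omega
        · rw [hv0s j hj]; exact Nat.zero_le _
      obtain ⟨lam', hF'⟩ := hF.exchange x (x0 ⟨i, hi⟩) hx1 (by rw [hx0e, hxe])
        (fun j => I j - vec x j + v0 j) (fun j => by
          have := hxI j
          rw [hv0]; beta_reduce; omega)
      have hdτ1 : d * (τ + 1) = d * τ + d := by ring
      refine ⟨fun j => J j + w j - v0 j, fun j => l j + v0 j, ⟨?_, ?_, ?_, ?_, ?_, ?_, ?_⟩,
        lam', _, hF', ?_⟩
      · intro j hj; beta_reduce; rw [q1 j hj, hv0s j hj]
      · intro j hj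
        have := q2 j hj
        beta_reduce; rw [hv0s j hj]; omega
      · intro j
        have := q3 j
        have := hv0J j
        beta_reduce; omega
      · rw [Finset.sum_add_distrib, hdτ1]; omega
      · have h2 : ∑ j, (J j + w j - v0 j) ≤ ∑ j, J j + ∑ j, w j := by
          rw [← Finset.sum_add_distrib]
          exact Finset.sum_le_sum fun j _ => by omega
        beta_reduce
        rw [hdτ1]
        omega
      · have h2 : ∑ j ∈ Bnᶜ, (J j + w j - v0 j) = ∑ j ∈ Bnᶜ, J j + ∑ j ∈ Bnᶜ, w j := by
          rw [← Finset.sum_add_distrib]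
          refine Finset.sum_congr rfl fun j hj => ?_
          rw [hv0s j fun h => (Finset.mem_compl.1 hj) (hsub h)]
          omega
        have h3 : w j0 ≤ ∑ j ∈ Bnᶜ, w j := Finset.single_le_sum (f := w)
          (fun _ _ => Nat.zero_le _) (Finset.mem_compl.2 hj0)
        beta_reduce
        rw [h2]
        omega
      · intro j hj
        have h2 := q7 j hj
        have h3 : w j ≤ d := (Finset.single_le_sum (f := w) (fun _ _ => Nat.zero_le _)
            (Finset.mem_univ j)).trans hwd
        beta_reduce
        rw [hdτ1]
        omega
      · have h2 : ((fun j => J j + w j - v0 j) + fun j => I j - vec x j + v0 j)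
            = (fun j => J j + (I j - vec x j)) + w := by
          funext j
          have := hv0J j
          simp only [Pi.add_apply]
          omega
        rw [h2]
        exact hwfin
    obtain ⟨xw, hxw1, hxw2⟩ := mkι ⟨i, hi⟩ w (!b0) hw hws
    have hJw : (fun j => J j + (I j - vec x j)) + w = J + fun j => I j - vec x j + w j := by
      funext j; simp only [Pi.add_apply]; omega
    rw [hJw] at hwle hwfin
    have hcw := hcP1 i w (!b0) hw
    have hle1 : (cP i w : WithTop ℝ) + y (J + fun j => I j - vec x j + w j) ≤
        (((G i !b0).coeff w : ℝ) : WithTop ℝ) + y (J + fun j => I j - vec x j + w j) :=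
      add_le_add_left (WithTop.coe_le_coe.2 hcw) _
    have hcw2 : cP xw.1.1 xw.2.1 = cP i w := by rw [hxw2, hxw1]
    have hfinal := hxw xw hxw1 (fun j => I j - vec x j + w j) (fun j => by
        have := hxI j
        simp only [vec, hxw2] at this ⊢
        omega) (by
        rw [hcw2]
        exact hle1.trans hwle)
    rw [hcw2] at hfinal
    obtain ⟨hf1, hf2⟩ := hfinal
    have hceq : (G i !b0).coeff w = cP i w := by
      rw [← hf1] at hwle
      obtain ⟨Y, hY⟩ := WithTop.ne_top_iff_exists.1 hwfin
      rw [← hY] at hwle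
      have h2 : (G i !b0).coeff w + Y ≤ cP i w + Y := by exact_mod_cast hwle
      linarith
    have h2 : ∃ v ∈ (G i !b0).supp, (∀ j, j ∉ Bn → v j = 0) ∧
        (G i !b0).coeff v + ∑ j, (v j : ℝ) * a j = t ⟨i, hi⟩ := by
      refine ⟨w, hw, hws, ?_⟩
      rw [hceq]
      simp only [vec, hxw2] at hf2
      exact hf2
    intro b
    by_cases hb : b = b0
    · rw [hb]; exact h1
    · have : b = !b0 := by cases b <;> cases b0 <;> first | rfl | exact absurd rfl hb
      rw [this]; exact h2
  rw [(G i true).evalT_on Bn a _ (hlow true) (hatt true),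
    (G i false).evalT_on Bn a _ (hlow false) (hatt false)]
theorem expDeg_finite (n N : ℕ) : Finite {I : Exp n // expDeg I ≤ N} := by
  have : ({I : Exp n | expDeg I ≤ N}).Finite := by
    refine (Set.finite_Iic (fun _ : Fin n => N)).subset ?_
    intro I hI j
    exact (Finset.single_le_sum (f := I) (fun _ _ => Nat.zero_le _) (Finset.mem_univ j)).trans hI
  exact this

theorem TropPoly.shift_ge {n : ℕ} (f : TropPoly n) (a : Fin n → WithTop ℝ) (J I : Exp n) :
    (∑ j, J j • a j) + f.evalT a ≤ shiftCoeff f J I + ∑ j, I j • a j := by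
  unfold shiftCoeff
  split_ifs with h
  · have h1 : f.evalT a ≤ f.monoT (I - J) a := Finset.inf_le h.2
    have h2 : ∑ j, I j • a j = (∑ j, J j • a j) + ∑ j, (I - J) j • a j := by
      rw [← Finset.sum_add_distrib]
      refine Finset.sum_congr rfl fun j _ => ?_
      rw [← add_nsmul]
      congr 1
      have h3 : J j ≤ I j := h.1 j
      simp only [Pi.sub_apply]
      omega
    rw [h2, add_left_comm]
    exact add_le_add_right h1 _
  · simp

theorem TropPoly.shift_att {n : ℕ} (f : TropPoly n) (a : Fin n → WithTop ℝ) (J : Exp n) :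
    ∃ I, expDeg I ≤ expDeg J + f.deg ∧
      shiftCoeff f J I + ∑ j, I j • a j = (∑ j, J j • a j) + f.evalT a := by
  obtain ⟨w, hw, hwe⟩ := Finset.exists_mem_eq_inf f.supp f.supp_nonempty (fun I => f.monoT I a)
  refine ⟨J + w, ?_, ?_⟩
  · have h1 : expDeg w ≤ f.deg := Finset.le_sup hw
    have h2 : expDeg (J + w) = expDeg J + expDeg w := by
      simp [expDeg, Finset.sum_add_distrib]
    omega
  · have h1 : f.evalT a = f.monoT w a := hwe
    rw [h1]
    unfold shiftCoeff
    have h2 : J + w - J = w := by simp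
    rw [h2, if_pos ⟨le_self_add, hw⟩]
    unfold TropPoly.monoT
    rw [add_left_comm, ← Finset.sum_add_distrib]
    congr 1
    refine Finset.sum_congr rfl fun j _ => ?_
    rw [← add_nsmul]; rfl

theorem cert_no_root {n k : ℕ} (F : Fin k → TropPoly n × TropPoly n) (N : ℕ)
    (comb : MPComb n k) (hD : comb.DegLE F N)
    (hC : ∀ I : Exp n, expDeg I ≤ N → (comb.fCoeff F I = ⊤ ∧ comb.gCoeff F I = ⊤) ∨
          (comb.gCoeff F I ≠ ⊤ ∧ comb.gCoeff F I < comb.fCoeff F I))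
    (h0 : comb.gCoeff F 0 ≠ ⊤) (a : Fin n → WithTop ℝ)
    (ha : ∀ j, (F j).1.evalT a = (F j).2.evalT a) : False := by
  have := expDeg_finite n N
  have hz : expDeg (0 : Exp n) ≤ N := by simp [expDeg]
  have : Nonempty {I : Exp n // expDeg I ≤ N} := ⟨⟨0, hz⟩⟩
  obtain ⟨I0, hI0⟩ := Finite.exists_min
    (fun I : {I : Exp n // expDeg I ≤ N} => comb.gCoeff F I.1 + ∑ j, I.1 j • a j)
  have hμ : comb.gCoeff F I0.1 + ∑ j, I0.1 j • a j ≠ ⊤ := by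
    refine ne_top_of_le_ne_top ?_ (hI0 ⟨0, hz⟩)
    simpa using h0
  have : Nonempty (Fin comb.K) := ⟨⟨0, comb.K_pos⟩⟩
  obtain ⟨l, -, hl⟩ := Finset.exists_mem_eq_inf (Finset.univ : Finset (Fin comb.K))
    Finset.univ_nonempty (fun l : Fin comb.K =>
    (comb.c l : WithTop ℝ) + shiftCoeff (comb.q F l) (comb.J l) I0.1)
  have hl' : comb.gCoeff F I0.1 = (comb.c l : WithTop ℝ) + shiftCoeff (comb.q F l) (comb.J l) I0.1 := hl
  have hpq : (comb.p F l).evalT a = (comb.q F l).evalT a := by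
    unfold MPComb.p MPComb.q
    split_ifs
    · exact (ha _).symm
    · exact ha _
  have hdp : (comb.p F l).deg ≤ max (F (comb.idx l)).1.deg (F (comb.idx l)).2.deg := by
    unfold MPComb.p
    split_ifs
    · exact le_max_right _ _
    · exact le_max_left _ _
  obtain ⟨I1, hI1, hI1e⟩ := (comb.p F l).shift_att a (comb.J l)
  have hI1N : expDeg I1 ≤ N := by
    have := hD l
    omega
  have h1 : comb.fCoeff F I1 + ∑ j, I1 j • a j ≤ comb.gCoeff F I0.1 + ∑ j, I0.1 j • a j := by
    have h2 : comb.fCoeff F I1 ≤ (comb.c l : WithTop ℝ) + shiftCoeff (comb.p F l) (comb.J l) I1 :=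
      Finset.inf_le (Finset.mem_univ l)
    refine (add_le_add_left h2 _).trans ?_
    rw [add_assoc, hI1e, hpq, hl', add_assoc]
    exact add_le_add_right (TropPoly.shift_ge _ _ _ _) _
  have h2 := ne_top_of_le_ne_top hμ h1
  obtain ⟨h3, h4⟩ := WithTop.add_ne_top.1 h2
  rcases hC I1 hI1N with h | ⟨h5, h6⟩
  · exact h3 h.1
  · have h7 := WithTop.add_lt_add_right h4 h6
    exact absurd (h7.trans_le h1) (not_lt.2 (hI0 ⟨I1, hI1N⟩))

theorem shiftCoeff_add {n : ℕ} (f : TropPoly n) (J w : Exp n) (hw : w ∈ f.supp) :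
    shiftCoeff f J (J + w) = (f.coeff w : WithTop ℝ) := by
  unfold shiftCoeff
  have h2 : J + w - J = w := by simp
  rw [h2, if_pos ⟨le_self_add, hw⟩]

theorem shiftCoeff_ne_top {n : ℕ} {f : TropPoly n} {J I : Exp n} (h : shiftCoeff f J I ≠ ⊤) :
    ∃ w ∈ f.supp, I = J + w := by
  unfold shiftCoeff at h
  split_ifs at h with h1
  · exact ⟨I - J, h1.2, (add_tsub_cancel_of_le h1.1).symm⟩
  · exact absurd rfl h

theorem no_root_cert {n k d : ℕ} (hk : 1 ≤ k) (hd : 1 ≤ d)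
    (F : Fin k → TropPoly n × TropPoly n)
    (hdeg : ∀ j : Fin k, max (F j).1.deg (F j).2.deg ≤ d) (N : ℕ)
    (hN : N = 2 * (n + 2) ^ 2 * k * (4 * d) ^ (min n k + 2))
    (hno : ¬ ∃ a : Fin n → WithTop ℝ, ∀ j : Fin k, (F j).1.evalT a = (F j).2.evalT a) :
    ∃ comb : MPComb n k, comb.DegLE F N ∧
        (∀ I : Exp n, expDeg I ≤ N →
          (comb.fCoeff F I = ⊤ ∧ comb.gCoeff F I = ⊤) ∨
          (comb.gCoeff F I ≠ ⊤ ∧ comb.gCoeff F I < comb.fCoeff F I)) ∧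
        comb.gCoeff F 0 ≠ ⊤ := by
  have fin1 := expDeg_finite n N
  have fin2 : Finite {J : Exp n // expDeg J + d ≤ N} :=
    Finite.of_injective (β := {I : Exp n // expDeg I ≤ N})
      (fun J => ⟨J.1, (Nat.le_add_right _ _).trans J.2⟩)
      (fun x y h => Subtype.ext (congrArg (fun z => z.1) h))
  have := Fintype.ofFinite {I : Exp n // expDeg I ≤ N}
  have := Fintype.ofFinite {J : Exp n // expDeg J + d ≤ N}
  have hz : expDeg (0 : Exp n) ≤ N := by simp [expDeg]
  obtain ⟨G, hG⟩ : ∃ G : Fin k → Bool → TropPoly n,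
      G = fun i b => if b then (F i).2 else (F i).1 := ⟨_, rfl⟩
  have hGt : ∀ i, G i true = (F i).2 := fun i => by rw [hG]; rfl
  have hGf : ∀ i, G i false = (F i).1 := fun i => by rw [hG]; rfl
  have hGd : ∀ i b, ∀ v ∈ (G i b).supp, expDeg v ≤ d := by
    intro i b v hv
    have h1 : expDeg v ≤ (G i b).deg := Finset.le_sup hv
    have h2 := hdeg i
    have h3 := max_le_iff.1 h2
    cases b
    · rw [hGf] at h1; exact h1.trans h3.1
    · rw [hGt] at h1; exact h1.trans h3.2
  rcases trop_dual (C := {I : Exp n // expDeg I ≤ N})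
    (R := Fin k × {J : Exp n // expDeg J + d ≤ N} × Bool)
    (fun r c => shiftCoeff (G r.1 r.2.2) r.2.1.1 c.1)
    (fun r c => shiftCoeff (G r.1 !r.2.2) r.2.1.1 c.1) ⟨0, hz⟩ with
    ⟨y, hy0, hy⟩ | ⟨z, hz1, hz2⟩
  · exfalso
    apply hno
    obtain ⟨y', hy'⟩ : ∃ y' : Exp n → WithTop ℝ,
        y' = fun I => if h : expDeg I ≤ N then y ⟨I, h⟩ else ⊤ := ⟨_, rfl⟩
    have hyc : ∀ c : {I : Exp n // expDeg I ≤ N}, y' c.1 = y c := by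
      intro c; rw [hy']; exact dif_pos c.2
    obtain ⟨a, ha⟩ := dual_null hk hd G hGd y' (by rw [hyc ⟨0, hz⟩]; exact hy0) N hN (by
      intro i b J hJ v hv
      have hJv : expDeg (J + v) ≤ N := by
        have h2 : expDeg (J + v) = expDeg J + expDeg v := by
          simp [expDeg, Finset.sum_add_distrib]
        have h3 := hGd i b v hv
        have h4 : expDeg J + d ≤ N := hJ
        omega
      obtain ⟨c, hc⟩ := hy (i, ⟨J, hJ⟩, !b) ⟨J + v, hJv⟩
      simp only [Bool.not_not] at hc
      rw [shiftCoeff_add _ _ _ hv, ← hyc, ← hyc] at hc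
      by_cases htop : shiftCoeff (G i !b) J c.1 = ⊤
      · rw [htop, top_add, top_le_iff] at hc
        rw [hc]
        obtain ⟨w, hw⟩ := (G i !b).supp_nonempty
        exact ⟨w, hw, le_top⟩
      · obtain ⟨w, hw, hcw⟩ := shiftCoeff_ne_top htop
        refine ⟨w, hw, ?_⟩
        rw [hcw, shiftCoeff_add _ _ _ hw] at hc
        exact hc)
    refine ⟨a, fun i => ?_⟩
    rw [← hGt, ← hGf]
    exact (ha i).symm
  · obtain ⟨r0, hr0⟩ := hz2
    have hzr0 := (WithTop.add_ne_top.1 hr0).1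
    obtain ⟨e⟩ : Nonempty ({r // z r ≠ ⊤} ≃ Fin (Fintype.card {r // z r ≠ ⊤})) :=
      ⟨Fintype.equivFin _⟩
    let comb : MPComb n k :=
      { K := Fintype.card {r // z r ≠ ⊤}
        K_pos := Fintype.card_pos_iff.2 ⟨⟨r0, hzr0⟩⟩
        c := fun l => (z (e.symm l).1).untop (e.symm l).2
        J := fun l => (e.symm l).1.2.1.1
        idx := fun l => (e.symm l).1.1
        flip := fun l => (e.symm l).1.2.2 }
    have hp : ∀ l : Fin comb.K, comb.p F l = G (e.symm l).1.1 (e.symm l).1.2.2 := by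
      intro l
      rw [hG]; rfl
    have hq : ∀ l : Fin comb.K, comb.q F l = G (e.symm l).1.1 !(e.symm l).1.2.2 := by
      intro l
      have h1 : comb.q F l = if (e.symm l).1.2.2 then (F (e.symm l).1.1).1
        else (F (e.symm l).1.1).2 := rfl
      rw [h1]
      cases (e.symm l).1.2.2
      · rw [Bool.not_false, hGt]; rfl
      · rw [Bool.not_true, hGf]; rfl
    have hc : ∀ l : Fin comb.K, (comb.c l : WithTop ℝ) = z (e.symm l).1 := by
      intro l
      exact WithTop.coe_untop _ _
    have hg : ∀ I r, comb.gCoeff F I ≤ z r + shiftCoeff (G r.1 !r.2.2) r.2.1.1 I := by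
      intro I r
      by_cases hr : z r = ⊤
      · rw [hr, top_add]; exact le_top
      · have h1 : comb.gCoeff F I ≤ (comb.c (e ⟨r, hr⟩) : WithTop ℝ) +
          shiftCoeff (comb.q F (e ⟨r, hr⟩)) (comb.J (e ⟨r, hr⟩)) I :=
          Finset.inf_le (Finset.mem_univ (e ⟨r, hr⟩))
        rw [hc, hq] at h1
        have h2 : comb.J (e ⟨r, hr⟩) = r.2.1.1 := by
          show (e.symm (e ⟨r, hr⟩)).1.2.1.1 = _
          rw [Equiv.symm_apply_apply]
        rw [h2, Equiv.symm_apply_apply] at h1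
        exact h1
    refine ⟨comb, ?_, ?_, ?_⟩
    · intro l
      have h1 := hdeg (comb.idx l)
      have h2 : expDeg (comb.J l) + d ≤ N := (e.symm l).1.2.1.2
      omega
    · intro I hI
      rcases hz1 ⟨I, hI⟩ with h | ⟨r, hr1, hr2⟩
      · left
        constructor
        · refine top_le_iff.1 (Finset.le_inf fun l _ => ?_)
          rw [hc, hp]
          exact (h (e.symm l).1).2.ge
        · refine top_le_iff.1 (Finset.le_inf fun l _ => ?_)
          rw [hc, hq]
          exact (h (e.symm l).1).1.ge
      · right
        refine ⟨ne_top_of_le_ne_top hr1 (hg I r), (hg I r).trans_lt ?_⟩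
        refine (Finset.lt_inf_iff (lt_top_iff_ne_top.2 hr1)).2 fun l _ => ?_
        rw [hc, hp]
        exact hr2 (e.symm l).1
    · exact ne_top_of_le_ne_top hr0 (hg 0 r0)

/-- **Min-plus primary Nullstellensatz over ℝ∞** : a system `F` of min-plus polynomials in
`n` variables over `ℝ∞`, each of degree at most `d ≥ 1`, has no root iff there is a
min-plus algebraic combination `(f,g)` of `F` of degree at most
`N = 2(n+2)²·k·(4d)^{min(n,k)+2}` such that for every exponent vector `I` with `|I| ≤ N`
either `f_I = g_I = +∞`, or `g_I` is finite and `g_I < f_I`, and additionally the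
constant term `g_0` is finite. -/
theorem minplus_primary_nullstellensatz_inf (n k d : ℕ) (hk : 1 ≤ k) (hd : 1 ≤ d)
    (F : Fin k → TropPoly n × TropPoly n)
    (hdeg : ∀ j : Fin k, max (F j).1.deg (F j).2.deg ≤ d) :
    (¬ ∃ a : Fin n → WithTop ℝ, ∀ j : Fin k, (F j).1.evalT a = (F j).2.evalT a) ↔
      ∃ comb : MPComb n k,
        comb.DegLE F (2 * (n + 2) ^ 2 * k * (4 * d) ^ (min n k + 2)) ∧
        (∀ I : Exp n, expDeg I ≤ 2 * (n + 2) ^ 2 * k * (4 * d) ^ (min n k + 2) →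
          (comb.fCoeff F I = ⊤ ∧ comb.gCoeff F I = ⊤) ∨
          (comb.gCoeff F I ≠ ⊤ ∧ comb.gCoeff F I < comb.fCoeff F I)) ∧
        comb.gCoeff F 0 ≠ ⊤ := by
  constructor
  · intro hno
    exact no_root_cert hk hd F hdeg _ rfl hno
  · rintro ⟨comb, hD, hC, h0⟩ ⟨a, ha⟩
    exact cert_no_root F _ comb hD hC h0 a ha
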